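/- arXiv:1807.10905 — 2 statements merged into one kernel-verified Lean document; each statement's English description precedes it below -/
import Mathlib

section
/- Let n ≥ 4, let p be a harmonic homogeneous polynomial of degree m on ℝⁿ, let i ≥ 0 be an integer, and let σ = −n − m (the exceptional case). Then there exist real numbers c₀,…,c_{i+1} such that the function u(x) = |x|^{σ+2−m} (Σ_{j=0}^{i+1} c_j (log|x|)^j) p(x) satisfies Δu(x) = |x|^{σ−m} (log|x|)^i p(x) for all x ∈ ℝⁿ with x ≠ 0. (In spherical-harmonic notation: the equation Δu = r^σ (log r)^i G_m with σ + n + m = 0 has a solution of the form r^{σ+2}(Σ_{j=0}^{i+1} c_j (log r)^j) G_m.) -/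
open Real
open scoped BigOperators

noncomputable section

abbrev E (n : ℕ) := EuclideanSpace ℝ (Fin n)

/-- The Euclidean Laplacian of `f` at `x` (sum of second partial derivatives). -/
def lap (n : ℕ) (f : E n → ℝ) (x : E n) : ℝ :=
  ∑ i : Fin n, fderiv ℝ (fun y => fderiv ℝ f y (EuclideanSpace.single i 1)) x
    (EuclideanSpace.single i 1)

/-- `f` is a (real) polynomial function on `ℝⁿ`. -/
def IsPolyFun (n : ℕ) (f : E n → ℝ) : Prop :=
  ∃ P : MvPolynomial (Fin n) ℝ, ∀ x : E n, f x = MvPolynomial.eval (fun i => x i) P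

/-- `p` is a harmonic homogeneous polynomial of degree `m` on `ℝⁿ`. -/
def IsHHP (n m : ℕ) (p : E n → ℝ) : Prop :=
  IsPolyFun n p ∧ (∀ (c : ℝ) (x : E n), p (c • x) = c ^ m * p x) ∧ ∀ x : E n, lap n p x = 0

/-- A polynomial function is twice continuously differentiable. -/
lemma IsPolyFun.contDiff {n : ℕ} {f : E n → ℝ} (hf : IsPolyFun n f) : ContDiff ℝ 2 f := by
  obtain ⟨P, hP⟩ := hf
  rw [show f = fun x : E n => MvPolynomial.eval (fun i => x i) P from funext hP]
  clear hP
  induction P using MvPolynomial.induction_on with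
  | C a => simpa using contDiff_const
  | add P Q hP hQ => simpa using hP.add hQ
  | mul_X P i hP =>
    simp only [map_mul, MvPolynomial.eval_X]
    exact hP.mul (by fun_prop)

/-- Euler's identity for a differentiable homogeneous function. -/
lemma fderiv_apply_self_of_homogeneous {n m : ℕ} {p : E n → ℝ}
    (hp : ∀ (c : ℝ) (x : E n), p (c • x) = c ^ m * p x) {x : E n}
    (hd : DifferentiableAt ℝ p x) : fderiv ℝ p x x = m * p x := by
  have h₁ : HasDerivAt (fun c : ℝ => p (c • x)) (fderiv ℝ p x x) 1 := by
    have hl : HasDerivAt (fun c : ℝ => c • x) x 1 := by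
      simpa using (hasDerivAt_id (1 : ℝ)).smul_const x
    have hd' : HasFDerivAt p (fderiv ℝ p x) ((1 : ℝ) • x) := by
      simpa using hd.hasFDerivAt
    exact hd'.comp_hasDerivAt 1 hl
  have h₂ : HasDerivAt (fun c : ℝ => p (c • x)) (m * p x) 1 := by
    simp only [hp]
    simpa using (hasDerivAt_pow m (1 : ℝ)).mul_const (p x)
  exact h₁.unique h₂

lemma sum_coord_mul_fderiv {n : ℕ} (f : E n → ℝ) (x : E n) :
    ∑ k, x k * fderiv ℝ f x (EuclideanSpace.single k 1) = fderiv ℝ f x x := by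
  have hx : x = ∑ k, x k • EuclideanSpace.single k (1 : ℝ) := by
    simpa using ((EuclideanSpace.basisFun (Fin n) ℝ).sum_repr x).symm
  conv_rhs => arg 2; rw [hx]
  simp

lemma hasFDerivAt_norm_sq_innerSL {n : ℕ} (y : E n) :
    HasFDerivAt (fun z : E n => ‖z‖ ^ 2) ((2 : ℝ) • innerSL ℝ y) y := by
  refine (hasStrictFDerivAt_norm_sq y).hasFDerivAt.congr_fderiv ?_
  ext v
  simp

lemma hasFDerivAt_log_norm {n : ℕ} {y : E n} (hy : y ≠ 0) :
    HasFDerivAt (fun z : E n => Real.log ‖z‖) ((‖y‖ ^ 2)⁻¹ • innerSL ℝ y) y := by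
  have h := ((hasFDerivAt_norm_sq_innerSL y).log (pow_ne_zero 2 (norm_ne_zero_iff.2 hy))).const_mul
    (1 / 2 : ℝ)
  have hlog : (fun z : E n => Real.log ‖z‖) = fun z => 1 / 2 * Real.log (‖z‖ ^ 2) := by
    funext z
    rw [Real.log_pow]
    push_cast
    ring
  rw [hlog]
  refine h.congr_fderiv ?_
  ext v
  simp
  ring

/-- The Laplacian of the product of a radial function, written in the variable `log r`, and a
homogeneous harmonic polynomial. -/
lemma lap_comp_log_norm_mul {n m : ℕ} {p : E n → ℝ} (hp : IsHHP n m p) {Φ Φ₁ Φ₂ : ℝ → ℝ}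
    (h₁ : ∀ s, HasDerivAt Φ (Φ₁ s) s) (h₂ : ∀ s, HasDerivAt Φ₁ (Φ₂ s) s) {u : E n → ℝ}
    (hu : ∀ y, y ≠ 0 → u y = Φ (Real.log ‖y‖) * p y) {x : E n} (hx : x ≠ 0) :
    lap n u x = (‖x‖ ^ 2)⁻¹ *
      (Φ₂ (Real.log ‖x‖) + (n - 2 + 2 * m) * Φ₁ (Real.log ‖x‖)) * p x := by
  have hpc := hp.1.contDiff
  have hpd : Differentiable ℝ p := hpc.differentiable (by norm_num)
  have hpd' : Differentiable ℝ (fderiv ℝ p) :=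
    (hpc.fderiv_right (m := 1) (by norm_num)).differentiable (by norm_num)
  have hr : ‖x‖ ^ 2 ≠ 0 := pow_ne_zero 2 (norm_ne_zero_iff.2 hx)
  have first (k : Fin n) {y : E n} (hy : y ≠ 0) :
      fderiv ℝ u y (EuclideanSpace.single k 1) =
        Φ₁ (Real.log ‖y‖) * (y k * (‖y‖ ^ 2)⁻¹) * p y +
          Φ (Real.log ‖y‖) * fderiv ℝ p y (EuclideanSpace.single k 1) := by
    have hev : u =ᶠ[nhds y] fun z => Φ (Real.log ‖z‖) * p z := by
      filter_upwards [isOpen_ne.mem_nhds hy] with z hz using hu z hz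
    have h := ((h₁ (Real.log ‖y‖)).comp_hasFDerivAt y (hasFDerivAt_log_norm hy)).mul
      (hpd y).hasFDerivAt
    rw [hev.fderiv_eq, show (fun z => Φ (Real.log ‖z‖) * p z) =
      ((Φ ∘ fun z : E n => Real.log ‖z‖) * p) from rfl, h.fderiv]
    simp [EuclideanSpace.inner_single_right]
    ring
  have second (k : Fin n) :
      fderiv ℝ (fun y => fderiv ℝ u y (EuclideanSpace.single k 1)) x
          (EuclideanSpace.single k 1) =
        Φ₂ (Real.log ‖x‖) * ((‖x‖ ^ 2)⁻¹) ^ 2 * p x * x k ^ 2 +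
        Φ₁ (Real.log ‖x‖) * (‖x‖ ^ 2)⁻¹ * p x -
        2 * Φ₁ (Real.log ‖x‖) * ((‖x‖ ^ 2)⁻¹) ^ 2 * p x * x k ^ 2 +
        2 * Φ₁ (Real.log ‖x‖) * (‖x‖ ^ 2)⁻¹ *
          (x k * fderiv ℝ p x (EuclideanSpace.single k 1)) +
        Φ (Real.log ‖x‖) * fderiv ℝ (fun y => fderiv ℝ p y (EuclideanSpace.single k 1)) x
          (EuclideanSpace.single k 1) := by
    have hev : (fun y => fderiv ℝ u y (EuclideanSpace.single k 1)) =ᶠ[nhds x] fun y =>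
        Φ₁ (Real.log ‖y‖) * (y k * (‖y‖ ^ 2)⁻¹) * p y +
          Φ (Real.log ‖y‖) * fderiv ℝ p y (EuclideanSpace.single k 1) := by
      filter_upwards [isOpen_ne.mem_nhds hx] with y hy using first k hy
    have hl := hasFDerivAt_log_norm hx
    have hΦ : HasFDerivAt (fun y : E n => Φ (Real.log ‖y‖)) _ x :=
      (h₁ (Real.log ‖x‖)).comp_hasFDerivAt x hl
    have hΦ₁ : HasFDerivAt (fun y : E n => Φ₁ (Real.log ‖y‖)) _ x :=
      (h₂ (Real.log ‖x‖)).comp_hasFDerivAt x hl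
    have hk : HasFDerivAt (fun y : E n => y k) (EuclideanSpace.proj k : E n →L[ℝ] ℝ) x :=
      (EuclideanSpace.proj k : E n →L[ℝ] ℝ).hasFDerivAt
    have hinv : HasFDerivAt (fun y : E n => (‖y‖ ^ 2)⁻¹) _ x :=
      (hasDerivAt_inv hr).comp_hasFDerivAt x (hasFDerivAt_norm_sq_innerSL x)
    have hDp : HasFDerivAt (fun y => fderiv ℝ p y (EuclideanSpace.single k 1)) _ x :=
      ((hpd' x).clm_apply (differentiableAt_const _)).hasFDerivAt
    have h := ((hΦ₁.mul (hk.mul hinv)).mul (hpd x).hasFDerivAt).add (hΦ.mul hDp)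
    rw [hev.fderiv_eq]
    refine (DFunLike.congr_fun h.fderiv _).trans ?_
    simp [EuclideanSpace.inner_single_right]
    ring
  have hsq : ∑ k, x k ^ 2 = ‖x‖ ^ 2 := (EuclideanSpace.real_norm_sq_eq x).symm
  have hharm := hp.2.2 x
  unfold lap at hharm ⊢
  simp only [second, Finset.sum_add_distrib, Finset.sum_sub_distrib, ← Finset.mul_sum, hharm, hsq,
    sum_coord_mul_fderiv, fderiv_apply_self_of_homogeneous hp.2.1 (hpd x)]
  simp only [Finset.sum_const, Finset.card_univ, Fintype.card_fin, nsmul_eq_mul]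
  field_simp
  ring

open Polynomial in
/-- The equation `L'' + a L' = Xⁱ` has a polynomial solution of degree at most `i + 1`. -/
lemma exists_polynomial_derivative_eq {a : ℝ} (ha : a ≠ 0) (i : ℕ) :
    ∃ L : ℝ[X], L.natDegree < i + 2 ∧
      derivative (derivative L) + C a * derivative L = X ^ i := by
  induction i with
  | zero =>
    refine ⟨C a⁻¹ * X, (natDegree_C_mul_le _ _).trans_lt (by simp), ?_⟩
    simp [← C_mul, ha]
  | succ i ih =>
    obtain ⟨L, hdeg, hL⟩ := ih
    refine ⟨C (a * (i + 2))⁻¹ * X ^ (i + 2) - C ((i + 1) / a) * L, ?_, ?_⟩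
    · have h₁ := natDegree_C_mul_X_pow_le (a * (i + 2) : ℝ)⁻¹ (i + 2)
      have h₂ := natDegree_C_mul_le ((i + 1) / a : ℝ) L
      have h₃ := natDegree_sub_le (C (a * (i + 2) : ℝ)⁻¹ * X ^ (i + 2)) (C ((i + 1) / a : ℝ) * L)
      omega
    · have hi : (i + 2 : ℝ) ≠ 0 := by positivity
      have e₁ : C (a * (i + 2))⁻¹ * C (i + 2 : ℝ) * C a = 1 := by
        rw [← C_mul, ← C_mul, ← C_1]
        congr 1
        field_simp
      have e₂ : C (a * (i + 2))⁻¹ * C (i + 2 : ℝ) * C (i + 1 : ℝ) = C ((i + 1) / a) := by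
        rw [← C_mul, ← C_mul]
        congr 1
        field_simp
      have hd₁ : derivative (X ^ (i + 2) : ℝ[X]) = C (i + 2 : ℝ) * X ^ (i + 1) := by
        rw [derivative_X_pow]
        push_cast
        rfl
      have hd₂ : derivative (X ^ (i + 1) : ℝ[X]) = C (i + 1 : ℝ) * X ^ i := by
        rw [derivative_X_pow]
        push_cast
        rfl
      simp only [derivative_sub, derivative_C_mul, hd₁, hd₂]
      linear_combination X ^ (i + 1) * e₁ + X ^ i * e₂ - C ((i + 1) / a) * hL

/-- solvability of `Δu = r^σ (log r)^i G_m` in the exceptional case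
`σ = -n - m`, with a solution `r^{σ+2} (Σ_{j=0}^{i+1} c_j (log r)^j) G_m`. -/
theorem poisson_single_term_exceptional (n m i : ℕ) (hn : 4 ≤ n) (p : E n → ℝ)
    (hp : IsHHP n m p) (σ : ℝ) (hσ : σ = -(n:ℝ) - m) :
    ∃ c : ℕ → ℝ, ∀ x : E n, x ≠ 0 →
      lap n (fun y => ‖y‖ ^ (σ + 2 - m) *
          (∑ j ∈ Finset.range (i + 2), c j * (Real.log ‖y‖) ^ j) * p y) x =
        ‖x‖ ^ (σ - m) * (Real.log ‖x‖) ^ i * p x := by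
  have ha : σ + 2 - m ≠ 0 := by
    have : (4 : ℝ) ≤ n := by exact_mod_cast hn
    have : (0 : ℝ) ≤ m := m.cast_nonneg
    linarith
  set a := σ + 2 - m with ha_def
  obtain ⟨L, hdeg, hL⟩ := exists_polynomial_derivative_eq ha i
  refine ⟨L.coeff, fun x hx => ?_⟩
  have hexp (s : ℝ) : HasDerivAt (fun s => Real.exp (a * s)) (Real.exp (a * s) * a) s := by
    simpa using ((hasDerivAt_id s).const_mul a).exp
  have hrpow {y : E n} (hy : y ≠ 0) (b : ℝ) : ‖y‖ ^ b = Real.exp (b * Real.log ‖y‖) := by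
    rw [Real.rpow_def_of_pos (norm_pos_iff.2 hy), mul_comm]
  rw [lap_comp_log_norm_mul hp
    (Φ := fun s => Real.exp (a * s) * L.eval s)
    (fun s => (hexp s).mul (L.hasDerivAt s))
    (fun s => (((hexp s).mul_const a).mul (L.hasDerivAt s)).add
      ((hexp s).mul (L.derivative.hasDerivAt s)))
    (fun y hy => by rw [hrpow hy, Polynomial.eval_eq_sum_range' hdeg]) hx]
  have hLe := congrArg (Polynomial.eval (Real.log ‖x‖)) hL
  simp only [Polynomial.eval_add, Polynomial.eval_mul, Polynomial.eval_C, Polynomial.eval_pow,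
    Polynomial.eval_X] at hLe
  have hpow : ‖x‖ ^ (σ - m) = (‖x‖ ^ 2)⁻¹ * Real.exp (a * Real.log ‖x‖) := by
    rw [← hrpow hx, show σ - m = a - 2 by rw [ha_def]; ring,
      Real.rpow_sub (norm_pos_iff.2 hx), Real.rpow_two]
    ring
  have hnm : (n : ℝ) - 2 + 2 * m = -a := by rw [ha_def, hσ]; ring
  rw [hpow, hnm, ← hLe]
  ring
end
end

section
/- Let n ≥ 3, R ≥ 1, let p ≥ 1 be an integer and let ε ∈ (0,1). Let G be a smooth function on {x ∈ ℝⁿ : |x| ≥ R} with G = O(−2−p−ε). Then there exists a smooth function V on {x ∈ ℝⁿ : |x| ≥ R} such that ΔV = G on {|x| > R} and V = O(−p−ε). -/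
open Real
open scoped BigOperators

noncomputable section

/-- The exterior region `{x : ℝⁿ | R ≤ |x|}`. -/
def Sset (n : ℕ) (R : ℝ) : Set (E n) := {x : E n | R ≤ ‖x‖}

/-- `u = O(-q)` on `{|x| ≥ R}`: all rescaled iterated derivatives decay like `|x|^{-q}`. -/
def BigOh (n : ℕ) (R q : ℝ) (u : E n → ℝ) : Prop :=
  ∀ j : ℕ, ∃ C : ℝ, ∀ x ∈ Sset n R,
    ‖x‖ ^ j * ‖iteratedFDerivWithin ℝ j u (Sset n R) x‖ ≤ C * ‖x‖ ^ (-q)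

/-- `u` has an expansion with terms in `A` up to order `-q` on `{|x| ≥ R}`. -/
def HasExpansion (n : ℕ) (R : ℝ) (A : Set (E n → ℝ)) (q : ℝ) (u : E n → ℝ) : Prop :=
  ∃ ε : ℝ, ε ∈ Set.Ioo (0:ℝ) 1 ∧ ∃ v ∈ Submodule.span ℝ A,
    BigOh n R (q + ε) (fun x => u x - v x)

open Set Filter Topology MeasureTheory
open scoped ContDiff FourierTransform

/-- The standard basis vector `eᵢ` of `ℝⁿ`. -/
abbrev basisVec {n : ℕ} (i : Fin n) : E n := EuclideanSpace.single i (1 : ℝ)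

/-- The `i`-th partial derivative. -/
def partialD {n : ℕ} (i : Fin n) (f : E n → ℝ) (x : E n) : ℝ := fderiv ℝ f x (basisVec i)

lemma lap_eq_sum {n : ℕ} (f : E n → ℝ) (x : E n) :
    lap n f x = ∑ i, partialD i (partialD i f) x := rfl

lemma norm_basisVec {n : ℕ} (i : Fin n) : ‖basisVec i‖ = 1 := by simp [basisVec]

lemma partialD_congr {n : ℕ} {i : Fin n} {f g : E n → ℝ} {x : E n} (h : f =ᶠ[𝓝 x] g) :
    partialD i f x = partialD i g x := by
  simp only [partialD, h.fderiv_eq]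

lemma partialD_congr_nhds {n : ℕ} {i : Fin n} {f g : E n → ℝ} {x : E n} (h : f =ᶠ[𝓝 x] g) :
    partialD i f =ᶠ[𝓝 x] partialD i g := by
  filter_upwards [h.eventually_nhds] with y hy using partialD_congr hy

lemma lap_congr {n : ℕ} {f g : E n → ℝ} {x : E n} (h : f =ᶠ[𝓝 x] g) :
    lap n f x = lap n g x := by
  simp only [lap_eq_sum]
  exact Finset.sum_congr rfl fun i _ => partialD_congr (partialD_congr_nhds h)

lemma HasFDerivAt.partialD_eq {n : ℕ} {i : Fin n} {f : E n → ℝ} {x : E n} {f' : E n →L[ℝ] ℝ}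
    (h : HasFDerivAt f f' x) : partialD i f x = f' (basisVec i) := by
  rw [partialD, h.fderiv]

lemma contDiffAt_partialD {n : ℕ} {i : Fin n} {f : E n → ℝ} {x : E n} {k m : ℕ∞ω}
    (h : ContDiffAt ℝ k f x) (hk : m + 1 ≤ k) : ContDiffAt ℝ m (partialD i f) x :=
  (h.fderiv_right hk).clm_apply contDiffAt_const

lemma contDiff_partialD {n : ℕ} (i : Fin n) {f : E n → ℝ} (h : ContDiff ℝ ∞ f) :
    ContDiff ℝ ∞ (partialD i f) :=
  (h.fderiv_right (by simp)).clm_apply contDiff_const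

lemma contDiff_lap {n : ℕ} {f : E n → ℝ} (h : ContDiff ℝ ∞ f) : ContDiff ℝ ∞ (lap n f) := by
  have : lap n f = fun x => ∑ i, partialD i (partialD i f) x := rfl
  rw [this]
  exact ContDiff.sum fun i _ => contDiff_partialD i (contDiff_partialD i h)

lemma partialD_add {n : ℕ} {i : Fin n} {f g : E n → ℝ} {x : E n}
    (hf : DifferentiableAt ℝ f x) (hg : DifferentiableAt ℝ g x) :
    partialD i (fun y => f y + g y) x = partialD i f x + partialD i g x := by
  rw [(hf.hasFDerivAt.fun_add hg.hasFDerivAt).partialD_eq]; simp [partialD]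

lemma partialD_const_mul {n : ℕ} {i : Fin n} {f : E n → ℝ} {x : E n} (c : ℝ)
    (hf : DifferentiableAt ℝ f x) :
    partialD i (fun y => c * f y) x = c * partialD i f x := by
  rw [(hf.hasFDerivAt.const_mul c).partialD_eq]; simp [partialD]

lemma partialD_mul {n : ℕ} {i : Fin n} {f g : E n → ℝ} {x : E n}
    (hf : DifferentiableAt ℝ f x) (hg : DifferentiableAt ℝ g x) :
    partialD i (fun y => f y * g y) x = f x * partialD i g x + g x * partialD i f x := by
  rw [(hf.hasFDerivAt.fun_mul hg.hasFDerivAt).partialD_eq]; simp [partialD]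

lemma partialD_sum {n : ℕ} {i : Fin n} {ι : Type*} (s : Finset ι) {f : ι → E n → ℝ} {x : E n}
    (hf : ∀ k ∈ s, DifferentiableAt ℝ (f k) x) :
    partialD i (fun y => ∑ k ∈ s, f k y) x = ∑ k ∈ s, partialD i (f k) x := by
  rw [(HasFDerivAt.fun_sum fun k hk => (hf k hk).hasFDerivAt).partialD_eq]
  simp [partialD]

lemma partialD_comm {n : ℕ} (i j : Fin n) {f : E n → ℝ} {x : E n} (hf : ContDiffAt ℝ 2 f x) :
    partialD i (partialD j f) x = partialD j (partialD i f) x := by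
  have key : ∀ a b : Fin n, partialD a (partialD b f) x
      = fderiv ℝ (fderiv ℝ f) x (basisVec a) (basisVec b) := by
    intro a b
    have h1 : DifferentiableAt ℝ (fderiv ℝ f) x :=
      (hf.fderiv_right (m := 1) (by norm_num)).differentiableAt (by norm_num)
    have := (h1.hasFDerivAt.clm_apply (hasFDerivAt_const (basisVec b) x)).partialD_eq (i := a)
    simp at this
    exact this
  rw [key, key]
  exact (hf.isSymmSndFDerivAt (by simp)).eq _ _

lemma lap_add {n : ℕ} {f g : E n → ℝ} {x : E n} (hf : ContDiffAt ℝ 2 f x)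
    (hg : ContDiffAt ℝ 2 g x) :
    lap n (fun y => f y + g y) x = lap n f x + lap n g x := by
  simp only [lap_eq_sum, ← Finset.sum_add_distrib]
  refine Finset.sum_congr rfl fun i _ => ?_
  have h1 : partialD i (fun y => f y + g y) =ᶠ[𝓝 x] fun y => partialD i f y + partialD i g y := by
    filter_upwards [hf.eventually (by simp), hg.eventually (by simp)] with y h1 h2
    exact partialD_add (h1.differentiableAt (by norm_num)) (h2.differentiableAt (by norm_num))
  rw [partialD_congr h1]
  exact partialD_add
    ((contDiffAt_partialD (m := 1) hf (by norm_num)).differentiableAt (by norm_num))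
    ((contDiffAt_partialD (m := 1) hg (by norm_num)).differentiableAt (by norm_num))

lemma lap_const_mul {n : ℕ} {f : E n → ℝ} {x : E n} (c : ℝ) (hf : ContDiffAt ℝ 2 f x) :
    lap n (fun y => c * f y) x = c * lap n f x := by
  simp only [lap_eq_sum, Finset.mul_sum]
  refine Finset.sum_congr rfl fun i _ => ?_
  have h1 : partialD i (fun y => c * f y) =ᶠ[𝓝 x] fun y => c * partialD i f y := by
    filter_upwards [hf.eventually (by simp)] with y h1
    exact partialD_const_mul c (h1.differentiableAt (by norm_num))
  rw [partialD_congr h1]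
  exact partialD_const_mul c
    ((contDiffAt_partialD (m := 1) hf (by norm_num)).differentiableAt (by norm_num))

lemma lap_sum {n : ℕ} {ι : Type*} (s : Finset ι) {f : ι → E n → ℝ} {x : E n}
    (hf : ∀ k ∈ s, ContDiffAt ℝ 2 (f k) x) :
    lap n (fun y => ∑ k ∈ s, f k y) x = ∑ k ∈ s, lap n (f k) x := by
  classical
  induction s using Finset.induction_on with
  | empty => simp [lap]
  | insert a s ha ih =>
    simp only [Finset.sum_insert ha]
    rw [lap_add (hf a (by simp)) (ContDiffAt.sum fun k hk => hf k (by simp [hk])),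
      ih fun k hk => hf k (by simp [hk])]

lemma lap_partialD {n : ℕ} (i : Fin n) {f : E n → ℝ} (hf : ContDiff ℝ ∞ f) (x : E n) :
    lap n (partialD i f) x = partialD i (lap n f) x := by
  have h2 : ∀ {g : E n → ℝ}, ContDiff ℝ ∞ g → ∀ y, ContDiffAt ℝ 2 g y := fun hg _ =>
    (contDiff_infty.1 hg 2).contDiffAt
  have : lap n f = fun x => ∑ j, partialD j (partialD j f) x := rfl
  rw [this, partialD_sum _ fun j _ => ((contDiff_partialD j
    (contDiff_partialD j hf)).differentiable (by simp)) x, lap_eq_sum]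
  refine Finset.sum_congr rfl fun j _ => ?_
  rw [partialD_comm i j (h2 (contDiff_partialD j hf) x)]
  refine partialD_congr (Eventually.of_forall fun y => partialD_comm j i (h2 hf y))

lemma hasDerivAt_comp_line {n : ℕ} {i : Fin n} {f : E n → ℝ} {x : E n} {t : ℝ}
    (h : DifferentiableAt ℝ f (x + t • basisVec i)) :
    HasDerivAt (fun s : ℝ => f (x + s • basisVec i)) (partialD i f (x + t • basisVec i)) t := by
  have h1 : HasDerivAt (fun s : ℝ => x + s • basisVec i) (basisVec i) t := by
    simpa using ((hasDerivAt_id t).smul_const (basisVec i)).const_add x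
  exact h.hasFDerivAt.comp_hasDerivAt t h1

/-- Second-order necessary condition for a local minimum, in coordinate directions. -/
lemma IsLocalMin.partialD_partialD_nonneg {n : ℕ} {h : E n → ℝ} {x : E n}
    (hmin : IsLocalMin h x) (hc : ContDiffAt ℝ 2 h x) (i : Fin n) :
    0 ≤ partialD i (partialD i h) x := by
  by_contra! hneg
  set g : ℝ → ℝ := fun s => h (x + s • basisVec i)
  have hline : Tendsto (fun s : ℝ => x + s • basisVec i) (𝓝 0) (𝓝 x) := by
    have : Continuous fun s : ℝ => x + s • basisVec i := by fun_prop
    simpa using this.tendsto 0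
  have hd : deriv g =ᶠ[𝓝 0] fun s => partialD i h (x + s • basisVec i) := by
    filter_upwards [hline.eventually (hc.eventually (by simp))] with s hs
    exact (hasDerivAt_comp_line (hs.differentiableAt (by norm_num))).deriv
  have hdd : deriv (deriv g) 0 = partialD i (partialD i h) x := by
    rw [hd.deriv_eq]
    have h1 : DifferentiableAt ℝ (partialD i h) (x + (0 : ℝ) • basisVec i) := by
      simpa using (contDiffAt_partialD (m := 1) hc (by norm_num)).differentiableAt (by norm_num)
    simpa using (hasDerivAt_comp_line h1).deriv
  have hgmin : IsLocalMin g 0 := by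
    have := hline.eventually hmin
    simpa [IsLocalMin, IsMinFilter, g] using this
  have hgc : ContinuousAt g 0 := by
    have : ContinuousAt h (x + (0 : ℝ) • basisVec i) := by simpa using hc.continuousAt
    exact ContinuousAt.comp (f := fun s : ℝ => x + s • basisVec i) this (by fun_prop)
  have hgmax : IsLocalMax g 0 :=
    isLocalMax_of_deriv_deriv_neg (hdd ▸ hneg) hgmin.deriv_eq_zero hgc
  have hconst : g =ᶠ[𝓝 0] fun _ => g 0 := by
    filter_upwards [hgmin, hgmax] with s h1 h2 using le_antisymm h2 h1
  have : deriv (deriv g) 0 = 0 := by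
    have h1 : deriv g =ᶠ[𝓝 0] fun _ => 0 := by
      filter_upwards [hconst.eventually_nhds] with s hs
      rw [EventuallyEq.deriv_eq hs, deriv_const]
    rw [h1.deriv_eq, deriv_const]
  rw [hdd] at this
  exact hneg.ne this

lemma IsLocalMin.lap_nonneg {n : ℕ} {h : E n → ℝ} {x : E n}
    (hmin : IsLocalMin h x) (hc : ContDiffAt ℝ 2 h x) : 0 ≤ lap n h x :=
  Finset.sum_nonneg fun i _ => hmin.partialD_partialD_nonneg hc i

lemma partialD_norm_sq {n : ℕ} (i : Fin n) (x : E n) :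
    partialD i (fun y => ‖y‖ ^ 2) x = 2 * x i := by
  rw [(hasStrictFDerivAt_norm_sq x).hasFDerivAt.partialD_eq]
  simp [basisVec, EuclideanSpace.inner_single_right]

lemma partialD_coord {n : ℕ} (i j : Fin n) (x : E n) :
    partialD i (fun y => y j) x = if i = j then 1 else 0 := by
  refine (HasFDerivAt.partialD_eq (f := fun y : E n => y j)
    (EuclideanSpace.proj (𝕜 := ℝ) j).hasFDerivAt).trans ?_
  simp [basisVec, eq_comm]

lemma partialD_const {n : ℕ} (i : Fin n) (c : ℝ) (x : E n) :
    partialD i (fun _ => c) x = 0 := by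
  simp [partialD]

lemma contDiff_coord {n : ℕ} (j : Fin n) {k : ℕ∞ω} : ContDiff ℝ k (fun y : E n => y j) :=
  (EuclideanSpace.proj (𝕜 := ℝ) j).contDiff

lemma lap_norm_sq {n : ℕ} (x : E n) : lap n (fun y => ‖y‖ ^ 2) x = 2 * n := by
  simp only [lap_eq_sum]
  have : ∀ i : Fin n, partialD i (partialD i fun y => ‖y‖ ^ 2) x = 2 := by
    intro i
    rw [partialD_congr (Eventually.of_forall (partialD_norm_sq i)),
      partialD_const_mul 2 ((contDiff_coord i (k := 1)).differentiable (by simp) x),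
      partialD_coord]
    simp
  simp [this, mul_comm]

lemma lap_coord {n : ℕ} (j : Fin n) (x : E n) : lap n (fun y => y j) x = 0 := by
  simp only [lap_eq_sum]
  refine Finset.sum_eq_zero fun i _ => ?_
  rw [partialD_congr (Eventually.of_forall (partialD_coord i j)), partialD_const]

lemma lap_coord_sq {n : ℕ} (j : Fin n) (x : E n) : lap n (fun y => y j ^ 2) x = 2 := by
  simp only [lap_eq_sum]
  have hd : ∀ y : E n, DifferentiableAt ℝ (fun y : E n => y j) y :=
    fun y => (contDiff_coord j (k := 1)).differentiable (by simp) y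
  have h1 : ∀ i (y : E n), partialD i (fun y => y j ^ 2) y = (if i = j then 2 else 0) * y j := by
    intro i y
    simp only [pow_two]
    rw [partialD_mul (hd y) (hd y), partialD_coord]
    split_ifs <;> ring
  have : ∀ i : Fin n, partialD i (partialD i fun y => y j ^ 2) x = if i = j then 2 else 0 := by
    intro i
    rw [partialD_congr (Eventually.of_forall (h1 i)), partialD_const_mul _ (hd x), partialD_coord]
    split_ifs <;> simp
  simp [this]

/-- A strictly superharmonic function on a half ball that is nonnegative on its boundary is
nonnegative. -/
lemma nonneg_of_lap_neg_halfBall {n : ℕ} {i : Fin n} {h : E n → ℝ} (hc : ContDiff ℝ 2 h) {d : ℝ}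
    (hlap : ∀ y, ‖y‖ < d → 0 < y i → lap n h y < 0)
    (hflat : ∀ y, ‖y‖ ≤ d → y i = 0 → 0 ≤ h y) (hsph : ∀ y, ‖y‖ = d → 0 ≤ y i → 0 ≤ h y) :
    ∀ y, ‖y‖ ≤ d → 0 ≤ y i → 0 ≤ h y := by
  intro y hy hyi
  set K : Set (E n) := Metric.closedBall 0 d ∩ {y | 0 ≤ y i}
  have hcont : Continuous fun y : E n => y i := (contDiff_coord i (k := 0)).continuous
  have hK : IsCompact K :=
    (isCompact_closedBall _ _).inter_right (isClosed_le continuous_const hcont)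
  have memK : ∀ z, z ∈ K ↔ ‖z‖ ≤ d ∧ 0 ≤ z i := by intro z; simp [K]
  obtain ⟨z, hzK, hz⟩ := hK.exists_isMinOn ⟨y, (memK y).2 ⟨hy, hyi⟩⟩ hc.continuous.continuousOn
  refine le_trans ?_ (hz ((memK y).2 ⟨hy, hyi⟩))
  obtain ⟨hz1, hz2⟩ := (memK z).1 hzK
  rcases hz1.eq_or_lt with hz1 | hz1
  · exact hsph z hz1 hz2
  rcases hz2.eq_or_lt with hz2 | hz2
  · exact hflat z hz1.le hz2.symm
  have hnhds : K ∈ 𝓝 z := by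
    filter_upwards [continuous_norm.continuousAt.eventually_lt continuousAt_const hz1,
      continuousAt_const.eventually_lt hcont.continuousAt hz2] with w h1 h2
    exact (memK w).2 ⟨h1.le, le_of_lt h2⟩
  exact absurd ((hz.isLocalMin hnhds).lap_nonneg hc.contDiffAt) (hlap z hz1 hz2).not_ge

/-- A strictly superharmonic function on `ℝⁿ` tending to zero at infinity is nonnegative. -/
lemma nonneg_of_lap_neg {n : ℕ} {h : E n → ℝ} (hc : ContDiff ℝ 2 h)
    (hlap : ∀ y, lap n h y < 0) (hlim : Tendsto h (cocompact (E n)) (𝓝 0)) (y : E n) :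
    0 ≤ h y := by
  by_contra! hy
  obtain ⟨z, hz⟩ := hc.continuous.exists_forall_le' y
    ((hlim.eventually (lt_mem_nhds hy)).mono fun _ => le_of_lt)
  exact absurd (IsLocalMin.lap_nonneg (Eventually.of_forall hz) hc.contDiffAt) (hlap z).not_ge

/-- Reflection in the hyperplane `yᵢ = 0`. -/
def coordReflection {n : ℕ} (i : Fin n) : E n →L[ℝ] E n :=
  ContinuousLinearMap.id ℝ (E n) -
    (2 : ℝ) • (EuclideanSpace.proj (𝕜 := ℝ) i).smulRight (basisVec i)

lemma coordReflection_apply {n : ℕ} (i : Fin n) (y : E n) :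
    coordReflection i y = y - (2 * y i) • basisVec i := by
  simp [coordReflection, mul_smul]

lemma norm_coordReflection {n : ℕ} (i : Fin n) (y : E n) : ‖coordReflection i y‖ = ‖y‖ := by
  rw [← sq_eq_sq₀ (norm_nonneg _) (norm_nonneg _), coordReflection_apply, norm_sub_sq_real,
    norm_smul, norm_basisVec, inner_smul_right]
  simp only [basisVec, EuclideanSpace.inner_single_right]
  simp [mul_pow]
  ring

lemma coordReflection_basisVec {n : ℕ} (i j : Fin n) :
    coordReflection i (basisVec j) = (if i = j then (-1 : ℝ) else 1) • basisVec j := by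
  rw [coordReflection_apply]
  by_cases h : i = j
  · subst h
    simp [basisVec]
    rw [← sub_eq_zero]
    module
  · simp [basisVec, h]

lemma partialD_comp_coordReflection {n : ℕ} (i j : Fin n) {u : E n → ℝ} {y : E n}
    (hu : DifferentiableAt ℝ u (coordReflection i y)) :
    partialD j (fun y => u (coordReflection i y)) y
      = (if i = j then -1 else 1) * partialD j u (coordReflection i y) := by
  have := (hu.hasFDerivAt.comp y (coordReflection i).hasFDerivAt).partialD_eq (i := j)
  rw [ContinuousLinearMap.comp_apply, coordReflection_basisVec, map_smul, smul_eq_mul] at this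
  exact this

lemma lap_comp_coordReflection {n : ℕ} (i : Fin n) {u : E n → ℝ} (hu : ContDiff ℝ 2 u) (y : E n) :
    lap n (fun y => u (coordReflection i y)) y = lap n u (coordReflection i y) := by
  simp only [lap_eq_sum]
  refine Finset.sum_congr rfl fun j _ => ?_
  have hd : ∀ z, DifferentiableAt ℝ (partialD j u) z := fun z =>
    (contDiffAt_partialD (m := 1) hu.contDiffAt (by norm_num)).differentiableAt (by norm_num)
  rw [partialD_congr (Eventually.of_forall fun y =>
      partialD_comp_coordReflection i j (hu.differentiable (by norm_num) _)),
    partialD_const_mul (f := fun y => partialD j u (coordReflection i y)) _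
      ((hd _).comp y (coordReflection i).differentiableAt),
    partialD_comp_coordReflection i j (hd _)]
  split_ifs <;> ring

lemma partialD_comp_add_left {n : ℕ} (i : Fin n) (u : E n → ℝ) (a y : E n) :
    partialD i (fun y => u (a + y)) y = partialD i u (a + y) := by
  simp only [partialD, fderiv_comp_add_left]

lemma lap_comp_add_left {n : ℕ} (u : E n → ℝ) (a y : E n) :
    lap n (fun y => u (a + y)) y = lap n u (a + y) := by
  simp only [lap_eq_sum]
  refine Finset.sum_congr rfl fun j _ => ?_
  rw [partialD_congr (Eventually.of_forall fun y => partialD_comp_add_left j u a y),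
    partialD_comp_add_left]

lemma partialD_le_of_bounds_zero {n : ℕ} (i : Fin n) {u : E n → ℝ} (hu : ContDiff ℝ 2 u) {d M F : ℝ}
    (hd : 0 < d) (hF : 0 < F) (hM : ∀ y, ‖y‖ ≤ d → |u y| ≤ M)
    (hlap : ∀ y, ‖y‖ ≤ d → |lap n u y| ≤ F) :
    partialD i u 0 ≤ n * M / d + F * d := by
  have hM0 : 0 ≤ M := (abs_nonneg _).trans (hM 0 (by simpa using hd.le))
  set c := n * M / d ^ 2 + F
  set a := M / d ^ 2
  have hc0 : 0 ≤ c := by positivity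
  have ha0 : 0 ≤ a := by positivity
  set h : E n → ℝ := fun y => (a * ‖y‖ ^ 2 + ((c * d) * y i + (-c) * y i ^ 2)) +
    ((-1 / 2) * u y + (1 / 2) * u (coordReflection i y)) with hdef
  have hur : ContDiff ℝ 2 fun y => u (coordReflection i y) := hu.comp (coordReflection i).contDiff
  have hns : ContDiff ℝ 2 fun y : E n => ‖y‖ ^ 2 := contDiff_norm_sq ℝ
  have c1 : ContDiff ℝ 2 fun y : E n => y i := contDiff_coord i
  have hc : ContDiff ℝ 2 h := by
    simp only [hdef]
    fun_prop
  have hlaph : ∀ y, lap n h y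
      = (a * (2 * n) + (c * d * 0 + (-c) * 2)) + (-1 / 2 * lap n u y
        + 1 / 2 * lap n u (coordReflection i y)) := by
    intro y
    simp only [hdef]
    have e1 : ContDiff ℝ 2 fun y : E n => c * d * y i := by fun_prop
    have e2 : ContDiff ℝ 2 fun y : E n => (-c) * y i ^ 2 := by fun_prop
    have e3 : ContDiff ℝ 2 fun y : E n => a * ‖y‖ ^ 2 := by fun_prop
    have e4 : ContDiff ℝ 2 fun y : E n => (-1 / 2) * u y := by fun_prop
    have e5 : ContDiff ℝ 2 fun y : E n => (1 / 2) * u (coordReflection i y) := by fun_prop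
    rw [lap_add (e3.add (e1.add e2)).contDiffAt (e4.add e5).contDiffAt,
      lap_add e3.contDiffAt (e1.add e2).contDiffAt, lap_add e1.contDiffAt e2.contDiffAt,
      lap_add e4.contDiffAt e5.contDiffAt, lap_const_mul _ hns.contDiffAt,
      lap_const_mul _ c1.contDiffAt, lap_const_mul _ (c1.pow 2).contDiffAt,
      lap_const_mul _ hu.contDiffAt, lap_const_mul _ hur.contDiffAt, lap_norm_sq, lap_coord,
      lap_coord_sq, lap_comp_coordReflection i hu]
  have key : ∀ y, ‖y‖ ≤ d → 0 ≤ y i → 0 ≤ h y := by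
    refine nonneg_of_lap_neg_halfBall hc (fun y hy _ => ?_) (fun y hy hyi => ?_)
      (fun y hy hyi => ?_)
    · rw [hlaph]
      have h1 := abs_le.1 (hlap y hy.le)
      have h2 := abs_le.1 (hlap (coordReflection i y) (by rw [norm_coordReflection]; exact hy.le))
      have : a * (2 * n) + (c * d * 0 + (-c) * 2) = -2 * F := by simp only [a, c]; ring
      linarith
    · have : coordReflection i y = y := by rw [coordReflection_apply, hyi]; simp
      simp only [hdef, this, hyi]
      nlinarith [mul_nonneg ha0 (sq_nonneg ‖y‖)]
    · have h1 := abs_le.1 (hM y hy.le)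
      have h2 := abs_le.1 (hM (coordReflection i y) (by rw [norm_coordReflection]; exact hy.le))
      have h3 : a * ‖y‖ ^ 2 = M := by rw [hy]; simp only [a]; field_simp
      have h4 : y i ≤ d := by
        rw [← hy]; exact (le_abs_self _).trans (PiLp.norm_apply_le y i)
      simp only [hdef, h3]
      nlinarith [mul_nonneg (mul_nonneg hc0 hyi) (sub_nonneg.2 h4)]
  have hpd : ∀ t : ℝ, 0 < t → t ≤ d →
      (1 / 2 * u (t • basisVec i) - 1 / 2 * u ((-t) • basisVec i)) / t ≤ a * t + c * d := by
    intro t ht htd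
    have hn : ‖t • basisVec i‖ = t := by rw [norm_smul, norm_basisVec, norm_eq_abs, abs_of_pos ht,
      mul_one]
    have hti : (t • basisVec i : E n) i = t := by simp [basisVec]
    have := key (t • basisVec i) (by rw [hn]; exact htd) (by rw [hti]; exact ht.le)
    have hr : coordReflection i (t • basisVec i) = (-t) • basisVec i := by
      rw [map_smul, coordReflection_basisVec]; simp
    simp only [hdef, hn, hti, hr] at this
    rw [div_le_iff₀ ht]
    nlinarith [mul_nonneg hc0 (sq_nonneg t)]
  have hlim : Tendsto (fun t : ℝ =>
      (1 / 2 * u (t • basisVec i) - 1 / 2 * u ((-t) • basisVec i)) / t) (𝓝[>] 0)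
      (𝓝 (partialD i u 0)) := by
    have hdf := hasDerivAt_comp_line (i := i) (x := 0) (t := 0) (f := u)
      (hu.differentiable (by norm_num) _)
    simp only [zero_smul, add_zero, zero_add] at hdf
    have hneg : HasDerivAt (fun s : ℝ => u ((-s) • basisVec i)) (-partialD i u 0) 0 := by
      have h0 : HasDerivAt (fun s : ℝ => u (s • basisVec i)) (partialD i u 0) (-0) := by
        simpa using hdf
      have h1 := HasDerivAt.scomp (0 : ℝ) h0 (hasDerivAt_neg (0 : ℝ))
      rw [neg_one_smul] at h1
      exact h1
    have := ((hdf.const_mul (1 / 2)).sub (hneg.const_mul (1 / 2))).tendsto_slope.mono_left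
      (nhdsWithin_mono 0 fun t (ht : 0 < t) => ht.ne')
    rw [show 1 / 2 * partialD i u 0 - 1 / 2 * -partialD i u 0 = partialD i u 0 by ring] at this
    refine this.congr fun t => ?_
    simp [slope, div_eq_inv_mul]
  have hlim2 : Tendsto (fun t : ℝ => a * t + c * d) (𝓝[>] 0) (𝓝 (a * 0 + c * d)) :=
    (Continuous.tendsto (by fun_prop) 0).mono_left nhdsWithin_le_nhds
  have := le_of_tendsto_of_tendsto hlim hlim2 (by
    filter_upwards [Ioc_mem_nhdsGT hd] with t ht using hpd t ht.1 ht.2)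
  refine this.trans_eq ?_
  simp only [c]
  field_simp
  ring

/-- Interior gradient estimate: the gradient at a point is controlled by bounds for the function
and its Laplacian on a ball. -/
lemma abs_partialD_le_of_bounds {n : ℕ} (i : Fin n) {u : E n → ℝ} (hu : ContDiff ℝ 2 u) (x : E n)
    {d M F : ℝ} (hd : 0 < d) (hF : 0 < F) (hM : ∀ y, ‖y - x‖ ≤ d → |u y| ≤ M)
    (hlap : ∀ y, ‖y - x‖ ≤ d → |lap n u y| ≤ F) :
    |partialD i u x| ≤ n * M / d + F * d := by
  have hv : ContDiff ℝ 2 fun y => u (x + y) := by fun_prop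
  have h1 := partialD_le_of_bounds_zero i hv hd hF (M := M) (fun y hy => hM _ (by simpa using hy))
    (fun y hy => by rw [lap_comp_add_left]; exact hlap _ (by simpa using hy))
  have h2 := partialD_le_of_bounds_zero i (u := fun y => (-1) * u (x + y)) (by fun_prop) hd hF
    (M := M) (fun y hy => by simpa using hM _ (by simpa using hy))
    (fun y hy => by
      rw [lap_const_mul _ hv.contDiffAt, lap_comp_add_left]
      simpa using hlap (x + y) (by simpa using hy))
  rw [partialD_const_mul _ (hv.differentiable (by norm_num) _)] at h2
  rw [partialD_comp_add_left, add_zero] at h1 h2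
  exact abs_le.2 ⟨by linarith, h1⟩

/-- The squared Japanese bracket `1 + |x|²`. -/
def wt {n : ℕ} (x : E n) : ℝ := 1 + ‖x‖ ^ 2

lemma one_le_wt {n : ℕ} (x : E n) : 1 ≤ wt x := by simp [wt]

lemma wt_pos {n : ℕ} (x : E n) : 0 < wt x := one_pos.trans_le (one_le_wt x)

lemma wt_rpow_pos {n : ℕ} (x : E n) (s : ℝ) : 0 < wt x ^ s := rpow_pos_of_pos (wt_pos x) s

lemma contDiff_wt {n : ℕ} {k : ℕ∞ω} : ContDiff ℝ k (wt : E n → ℝ) :=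
  contDiff_const.add (contDiff_norm_sq ℝ)

section SymbolClass

variable {F : Type*} [NormedAddCommGroup F] [NormedSpace ℝ F]
  {H : Type*} [NormedAddCommGroup H] [NormedSpace ℝ H]

/-- The derivatives of `f` of order at most `N` satisfy symbol bounds of order `-q` with
constant `C`. -/
def SymBound {n : ℕ} (N : ℕ) (q C : ℝ) (f : E n → F) : Prop :=
  ∀ j ≤ N, ∀ x, ‖iteratedFDeriv ℝ j f x‖ ≤ C * wt x ^ (-(q + j) / 2)

lemma SymBound.nonneg {n : ℕ} {N : ℕ} {q C : ℝ} {f : E n → F} (h : SymBound N q C f) : 0 ≤ C := by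
  have := (norm_nonneg _).trans (h 0 (Nat.zero_le _) 0)
  exact nonneg_of_mul_nonneg_left this (wt_rpow_pos _ _)

lemma SymBound.norm_le {n : ℕ} {N : ℕ} {q C : ℝ} {f : E n → F} (h : SymBound N q C f) (x : E n) :
    ‖f x‖ ≤ C * wt x ^ (-q / 2) := by
  simpa using h 0 (Nat.zero_le _) x

lemma symBound_zero {n : ℕ} {q C : ℝ} {f : E n → F} (h : ∀ x, ‖f x‖ ≤ C * wt x ^ (-q / 2)) :
    SymBound 0 q C f := by
  intro j hj x
  obtain rfl : j = 0 := by omega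
  simpa using h x

lemma SymBound.mono_const {n : ℕ} {N : ℕ} {q C C' : ℝ} {f : E n → F} (h : SymBound N q C f)
    (hC : C ≤ C') : SymBound N q C' f := fun j hj x =>
  (h j hj x).trans (mul_le_mul_of_nonneg_right hC (wt_rpow_pos _ _).le)

lemma SymBound.mono_order {n : ℕ} {N M : ℕ} {q C : ℝ} {f : E n → F} (h : SymBound N q C f)
    (hM : M ≤ N) : SymBound M q C f := fun j hj x => h j (hj.trans hM) x

lemma SymBound.fderiv {n : ℕ} {N : ℕ} {q C : ℝ} {f : E n → F} (h : SymBound (N + 1) q C f) :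
    SymBound N (q + 1) C (fderiv ℝ f) := by
  intro j hj x
  rw [norm_iteratedFDeriv_fderiv]
  refine (h (j + 1) (by omega) x).trans_eq ?_
  push_cast
  ring_nf

lemma symBound_succ {n : ℕ} {N : ℕ} {q C : ℝ} {f : E n → F} (h0 : SymBound 0 q C f)
    (h : SymBound N (q + 1) C (fderiv ℝ f)) : SymBound (N + 1) q C f := by
  intro j hj x
  rcases j with _ | j
  · exact h0 0 le_rfl x
  rw [← norm_iteratedFDeriv_fderiv]
  refine (h j (by omega) x).trans_eq ?_
  push_cast
  ring_nf

lemma SymBound.clm_comp {n : ℕ} {N : ℕ} {q C : ℝ} {f : E n → F} (h : SymBound N q C f)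
    (hf : ContDiff ℝ ∞ f) (L : F →L[ℝ] H) : SymBound N q (‖L‖ * C) (fun x => L (f x)) := by
  intro j hj x
  refine (L.norm_iteratedFDeriv_comp_left hf.contDiffAt (by exact_mod_cast le_top)).trans ?_
  rw [mul_assoc]
  exact mul_le_mul_of_nonneg_left (h j hj x) (norm_nonneg _)

lemma SymBound.sum {n : ℕ} {N : ℕ} {q C : ℝ} {ι : Type*} {s : Finset ι} {f : ι → E n → F}
    (hf : ∀ k ∈ s, SymBound N q C (f k)) (cf : ∀ k ∈ s, ContDiff ℝ ∞ (f k)) :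
    SymBound N q (s.card * C) (fun x => ∑ k ∈ s, f k x) := by
  intro j hj x
  have e : iteratedFDeriv ℝ j (fun x => ∑ k ∈ s, f k x) x = ∑ k ∈ s, iteratedFDeriv ℝ j (f k) x :=
    iteratedFDeriv_fun_sum_apply fun k hk =>
      ((cf k hk).of_le (by exact_mod_cast le_top)).contDiffAt
  rw [e]
  refine (norm_sum_le _ _).trans ((Finset.sum_le_sum fun k hk => hf k hk j hj x).trans_eq ?_)
  rw [Finset.sum_const, nsmul_eq_mul, mul_assoc]

lemma SymBound.mul {n : ℕ} {N : ℕ} {q r C D : ℝ} {f g : E n → ℝ} (hf : SymBound N q C f)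
    (hg : SymBound N r D g) (cf : ContDiff ℝ ∞ f) (cg : ContDiff ℝ ∞ g) :
    SymBound N (q + r) (2 ^ N * C * D) (fun x => f x * g x) := by
  intro j hj x
  refine (norm_iteratedFDeriv_mul_le cf cg x (n := j) (by exact_mod_cast le_top)).trans ?_
  have hterm : ∀ i ∈ Finset.range (j + 1), (j.choose i : ℝ) * ‖iteratedFDeriv ℝ i f x‖ *
      ‖iteratedFDeriv ℝ (j - i) g x‖ ≤ j.choose i * (C * D * wt x ^ (-(q + r + j) / 2)) := by
    intro i hi
    have hi' : i ≤ j := by simpa [Nat.lt_succ_iff] using hi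
    rw [mul_assoc]
    refine mul_le_mul_of_nonneg_left ?_ (by positivity)
    refine (mul_le_mul (hf i (hi'.trans hj) x) (hg (j - i) ((Nat.sub_le _ _).trans hj) x)
      (norm_nonneg _) (mul_nonneg hf.nonneg (wt_rpow_pos _ _).le)).trans_eq ?_
    have : wt x ^ (-(q + r + j) / 2) = wt x ^ (-(q + i) / 2) * wt x ^ (-(r + (j - i : ℕ)) / 2) := by
      rw [← rpow_add (wt_pos x)]
      push_cast [Nat.cast_sub hi']
      ring_nf
    rw [this]
    ring
  refine (Finset.sum_le_sum hterm).trans ?_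
  rw [← Finset.sum_mul]
  have h2 : (∑ i ∈ Finset.range (j + 1), (j.choose i : ℝ)) = 2 ^ j := by
    exact_mod_cast Nat.sum_range_choose j
  have h3 : (2 : ℝ) ^ j ≤ 2 ^ N := pow_le_pow_right₀ one_le_two hj
  rw [h2, mul_assoc (2 ^ N), mul_assoc (2 ^ N)]
  refine mul_le_mul_of_nonneg_right h3 ?_
  exact mul_nonneg (mul_nonneg hf.nonneg hg.nonneg) (wt_rpow_pos _ _).le

lemma norm_apply_basisVec_le {n : ℕ} (i : Fin n) :
    ‖ContinuousLinearMap.apply ℝ ℝ (basisVec i)‖ ≤ 1 := by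
  refine ContinuousLinearMap.opNorm_le_bound _ zero_le_one fun L => ?_
  simpa [norm_basisVec] using L.le_opNorm (basisVec i)

lemma SymBound.partialD {n : ℕ} {N : ℕ} {q C : ℝ} {f : E n → ℝ} (h : SymBound (N + 1) q C f)
    (hf : ContDiff ℝ ∞ f) (i : Fin n) : SymBound N (q + 1) C (partialD i f) := by
  refine SymBound.mono_const (h.fderiv.clm_comp (hf.fderiv_right (by simp))
    (ContinuousLinearMap.apply ℝ ℝ (basisVec i))) ?_
  exact mul_le_of_le_one_left h.nonneg (norm_apply_basisVec_le i)

lemma fderiv_eq_sum_partialD {n : ℕ} (f : E n → ℝ) (x : E n) :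
    fderiv ℝ f x = ∑ i, ContinuousLinearMap.smulRightL ℝ (E n) ℝ
      (EuclideanSpace.proj (𝕜 := ℝ) i) (partialD i f x) := by
  ext v
  have hv : v = ∑ i, v i • basisVec i := by
    ext j
    simp [basisVec, Finset.sum_apply, Pi.single_apply]
  conv_lhs => rw [hv]
  simp [partialD]

lemma symBound_succ_of_partialD {n : ℕ} {N : ℕ} {q C : ℝ} {f : E n → ℝ} (hf : ContDiff ℝ ∞ f)
    (h0 : SymBound 0 q C f) (h : ∀ i, SymBound N (q + 1) C (partialD i f)) :
    SymBound (N + 1) q ((n + 1) * C) f := by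
  have hC := h0.nonneg
  refine symBound_succ (h0.mono_const (by nlinarith [(Nat.cast_nonneg n : (0 : ℝ) ≤ n)])) ?_
  have h1 : SymBound N (q + 1) ((Finset.univ : Finset (Fin n)).card * C) (fun x => ∑ i,
      ContinuousLinearMap.smulRightL ℝ (E n) ℝ (EuclideanSpace.proj (𝕜 := ℝ) i)
        (partialD i f x)) := by
    refine SymBound.sum (fun i _ => ?_) (fun i _ => ?_)
    · refine ((h i).clm_comp (contDiff_partialD i hf) _).mono_const ?_
      refine mul_le_of_le_one_left hC ?_
      refine ContinuousLinearMap.opNorm_le_bound _ zero_le_one fun c => ?_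
      refine ContinuousLinearMap.opNorm_le_bound _ (by positivity) fun v => ?_
      simp only [ContinuousLinearMap.smulRightL_apply_apply,
        ContinuousLinearMap.smulRight_apply, norm_smul, one_mul]
      rw [mul_comm]
      exact mul_le_mul_of_nonneg_left (PiLp.norm_apply_le v i) (norm_nonneg _)
    · exact (ContinuousLinearMap.contDiff _).comp (contDiff_partialD i hf)
  have h2 := h1.mono_const (C' := (n + 1) * C) (by simp; nlinarith)
  rwa [← funext (fderiv_eq_sum_partialD f)] at h2

/-- A smooth function all of whose derivatives satisfy symbol bounds of order `-q`. -/
def IsSymbol {n : ℕ} (q : ℝ) (f : E n → F) : Prop :=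
  ContDiff ℝ ∞ f ∧ ∀ N : ℕ, ∃ C : ℝ, SymBound N q C f

lemma IsSymbol.sum {n : ℕ} {q : ℝ} {ι : Type*} {s : Finset ι} {f : ι → E n → F}
    (hf : ∀ k ∈ s, IsSymbol q (f k)) : IsSymbol q (fun x => ∑ k ∈ s, f k x) := by
  classical
  refine ⟨ContDiff.sum fun k hk => (hf k hk).1, fun N => ?_⟩
  have h : ∀ k, ∃ C : ℝ, 0 ≤ C ∧ (k ∈ s → SymBound N q C (f k)) := fun k => by
    by_cases hk : k ∈ s
    · obtain ⟨C, hC⟩ := (hf k hk).2 N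
      exact ⟨C, hC.nonneg, fun _ => hC⟩
    · exact ⟨0, le_rfl, fun h => absurd h hk⟩
  choose C hC0 hC using h
  exact ⟨_, SymBound.sum (C := ∑ k ∈ s, C k) (fun k hk => (hC k hk).mono_const
    (Finset.single_le_sum (fun i _ => hC0 i) hk)) fun k hk => (hf k hk).1⟩

lemma IsSymbol.mul {n : ℕ} {q r : ℝ} {f g : E n → ℝ} (hf : IsSymbol q f) (hg : IsSymbol r g) :
    IsSymbol (q + r) (fun x => f x * g x) := by
  refine ⟨hf.1.mul hg.1, fun N => ?_⟩
  obtain ⟨C, hC⟩ := hf.2 N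
  obtain ⟨D, hD⟩ := hg.2 N
  exact ⟨_, hC.mul hD hf.1 hg.1⟩

lemma IsSymbol.partialD {n : ℕ} {q : ℝ} {f : E n → ℝ} (hf : IsSymbol q f) (i : Fin n) :
    IsSymbol (q + 1) (partialD i f) :=
  ⟨contDiff_partialD i hf.1, fun N => (hf.2 (N + 1)).imp fun _ hC => hC.partialD hf.1 i⟩

lemma IsSymbol.fderiv {n : ℕ} {q : ℝ} {f : E n → F} (hf : IsSymbol q f) :
    IsSymbol (q + 1) (fderiv ℝ f) :=
  ⟨hf.1.fderiv_right (by simp), fun N => (hf.2 (N + 1)).imp fun _ hC => hC.fderiv⟩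

lemma rpow_norm_le_wt_rpow {n : ℕ} {x : E n} {s : ℝ} (hs : 0 ≤ s) : ‖x‖ ^ s ≤ wt x ^ (s / 2) := by
  have h : ‖x‖ ^ s = (‖x‖ ^ 2) ^ (s / 2) := by
    rw [← rpow_natCast, ← rpow_mul (norm_nonneg _)]; norm_num; ring_nf
  rw [h]
  exact rpow_le_rpow (by positivity) (by simp [wt]) (by positivity)

lemma isSymbol_const {n : ℕ} (c : ℝ) : IsSymbol 0 (fun _ : E n => c) := by
  refine ⟨contDiff_const, fun N => ⟨|c|, fun j _ x => ?_⟩⟩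
  rcases j with _ | j
  · simp
  · rw [iteratedFDeriv_const_of_ne (by simp)]
    simpa using mul_nonneg (abs_nonneg c) (wt_rpow_pos x _).le

lemma isSymbol_coord {n : ℕ} (i : Fin n) : IsSymbol (-1) (fun x : E n => x i) := by
  refine ⟨contDiff_coord i, fun N => ⟨(n + 1) * 1,
    SymBound.mono_order (N := N + 1) ?_ (Nat.le_succ N)⟩⟩
  refine symBound_succ_of_partialD (contDiff_coord i) (symBound_zero fun x => ?_) fun j => ?_
  · rw [one_mul, neg_neg]
    refine (PiLp.norm_apply_le x i).trans ?_
    simpa using rpow_norm_le_wt_rpow (x := x) zero_le_one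
  · have h1 : partialD j (fun x : E n => x i) = fun _ => if j = i then (1 : ℝ) else 0 :=
      funext fun x => partialD_coord j i x
    rw [h1, neg_add_cancel]
    intro k _ x
    rcases k with _ | k
    · split_ifs <;> simp
    · rw [iteratedFDeriv_const_of_ne (by simp)]
      simpa using (wt_rpow_pos x _).le

end SymbolClass

lemma contDiff_wt_rpow {n : ℕ} {k : ℕ∞ω} (s : ℝ) : ContDiff ℝ k (fun x : E n => wt x ^ s) :=
  contDiff_wt.rpow_const_of_ne fun x => (wt_pos x).ne'

lemma partialD_wt_rpow {n : ℕ} (i : Fin n) (s : ℝ) (x : E n) :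
    partialD i (fun y => wt y ^ s) x = (2 * s) * (x i * wt x ^ (s - 1)) := by
  have hw : HasFDerivAt (wt : E n → ℝ) (fderiv ℝ wt x) x :=
    ((contDiff_wt (k := 1)).differentiable (by simp) x).hasFDerivAt
  have h1 : partialD i wt x = 2 * x i := by
    have : (wt : E n → ℝ) = fun y => 1 + ‖y‖ ^ 2 := rfl
    rw [this, partialD_add (by fun_prop) ((contDiff_norm_sq ℝ (n := 1)).differentiable (by simp) x),
      partialD_const, partialD_norm_sq, zero_add]
  rw [(hw.rpow_const (p := s) (Or.inl (wt_pos x).ne')).partialD_eq]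
  have : fderiv ℝ wt x (basisVec i) = 2 * x i := h1
  simp only [_root_.smul_apply, this, smul_eq_mul]
  ring

lemma sum_coord_sq {n : ℕ} (x : E n) : ∑ i, x i ^ 2 = ‖x‖ ^ 2 := by
  simp [EuclideanSpace.norm_sq_eq]

lemma lap_wt_rpow {n : ℕ} (s : ℝ) (x : E n) :
    lap n (fun y => wt y ^ s) x
      = 2 * s * (n * wt x ^ (s - 1) + 2 * (s - 1) * ‖x‖ ^ 2 * wt x ^ (s - 2)) := by
  simp only [lap_eq_sum]
  have hw : DifferentiableAt ℝ (fun y : E n => wt y ^ (s - 1)) x :=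
    (contDiff_wt_rpow (k := 1) (s - 1)).differentiable (by simp) x
  have hc : ∀ i, DifferentiableAt ℝ (fun y : E n => y i) x := fun i =>
    (contDiff_coord (k := 1) i).differentiable (by simp) x
  have : ∀ i : Fin n, partialD i (partialD i fun y => wt y ^ s) x
      = 2 * s * (wt x ^ (s - 1) + 2 * (s - 1) * x i ^ 2 * wt x ^ (s - 2)) := by
    intro i
    rw [partialD_congr (Eventually.of_forall (partialD_wt_rpow i s)),
      partialD_const_mul _ ((hc i).fun_mul hw), partialD_mul (hc i) hw, partialD_coord,
      partialD_wt_rpow, if_pos rfl, show s - 1 - 1 = s - 2 by ring]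
    ring
  rw [Finset.sum_congr rfl fun i _ => this i, ← Finset.mul_sum, Finset.sum_add_distrib,
    ← Finset.sum_mul, ← Finset.mul_sum, sum_coord_sq]
  simp

lemma lap_wt_rpow_le {n : ℕ} {q : ℝ} (hq : 0 < q) (x : E n) :
    lap n (fun y => wt y ^ (-q / 2)) x ≤ -(q * (n - 2 - q)) * wt x ^ (-(q + 2) / 2) := by
  rw [lap_wt_rpow, show -q / 2 - 1 = -(q + 2) / 2 by ring]
  have h1 : wt x ^ (-(q + 2) / 2) = wt x * wt x ^ (-q / 2 - 2) := by
    rw [← rpow_one_add' (wt_pos x).le (by nlinarith)]; ring_nf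
  have h2 : ‖x‖ ^ 2 * wt x ^ (-q / 2 - 2) ≤ wt x ^ (-(q + 2) / 2) := by
    rw [h1]
    exact mul_le_mul_of_nonneg_right (by simp [wt]) (wt_rpow_pos _ _).le
  nlinarith [mul_le_mul_of_nonneg_left h2 (mul_pos hq (show 0 < q + 2 by linarith)).le]

lemma tendsto_wt_rpow_neg {n : ℕ} {s : ℝ} (hs : s < 0) :
    Tendsto (fun x : E n => wt x ^ s) (cocompact (E n)) (𝓝 0) := by
  have h1 : Tendsto (wt : E n → ℝ) (cocompact (E n)) atTop :=
    tendsto_atTop_add_const_left _ _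
      ((tendsto_pow_atTop two_ne_zero).comp (tendsto_norm_cocompact_atTop (E := E n)))
  have h2 := (tendsto_rpow_neg_atTop (y := -s) (by linarith)).comp h1
  rw [neg_neg] at h2
  exact h2

/-- Decay of solutions of the Poisson equation vanishing at infinity, by comparison. -/
lemma exists_abs_le_of_abs_lap_le {n : ℕ} {q : ℝ} (hq : 0 < q) (hqn : q < n - 2) :
    ∃ K > 0, ∀ u : E n → ℝ, ContDiff ℝ 2 u → Tendsto u (cocompact (E n)) (𝓝 0) → ∀ C > 0,
      (∀ x, |lap n u x| ≤ C * wt x ^ (-(q + 2) / 2)) → ∀ x, |u x| ≤ K * C * wt x ^ (-q / 2) := by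
  have hc : 0 < q * (n - 2 - q) := mul_pos hq (by linarith)
  refine ⟨2 / (q * (n - 2 - q)), by positivity, fun u hu hlim C hC hlap x => ?_⟩
  set K := 2 / (q * (n - 2 - q))
  have key : ∀ σ : ℝ, |σ| = 1 → 0 ≤ K * C * wt x ^ (-q / 2) + σ * u x := by
    intro σ hσ
    refine nonneg_of_lap_neg (h := fun x => K * C * wt x ^ (-q / 2) + σ * u x)
      ((contDiff_const.mul (contDiff_wt_rpow _)).add (contDiff_const.mul hu)) (fun y => ?_) ?_ x
    · rw [lap_add (contDiff_const.mul (contDiff_wt_rpow _)).contDiffAt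
        (contDiff_const.mul hu).contDiffAt, lap_const_mul _ (contDiff_wt_rpow _).contDiffAt,
        lap_const_mul _ hu.contDiffAt]
      have h1 := mul_le_mul_of_nonneg_left (lap_wt_rpow_le (n := n) hq y)
        (show 0 ≤ K * C by positivity)
      have h2 : σ * lap n u y ≤ C * wt y ^ (-(q + 2) / 2) :=
        (le_abs_self _).trans (by rw [abs_mul, hσ, one_mul]; exact hlap y)
      have h3 : K * C * (-(q * (n - 2 - q)) * wt y ^ (-(q + 2) / 2))
          = -2 * (C * wt y ^ (-(q + 2) / 2)) := by
        have hKc : K * (q * (n - 2 - q)) = 2 := div_mul_cancel₀ _ hc.ne'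
        linear_combination -C * wt y ^ (-(q + 2) / 2) * hKc
      have h4 := mul_pos hC (wt_rpow_pos y (-(q + 2) / 2))
      linarith
    · simpa using ((tendsto_wt_rpow_neg (n := n) (s := -q / 2) (by linarith)).const_mul
        (K * C)).add (hlim.const_mul σ)
  have h1 := key 1 (by simp)
  have h2 := key (-1) (by simp)
  exact abs_le.2 ⟨by linarith, by linarith⟩

lemma wt_le_four_mul_wt {n : ℕ} {x y : E n} (h : ‖y - x‖ ≤ √(wt x) / 2) : wt x ≤ 4 * wt y := by
  have h1 : ‖x‖ ≤ ‖y‖ + √(wt x) / 2 := by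
    have := norm_sub_norm_le x y
    rw [norm_sub_rev] at this
    linarith
  have h2 : √(wt x) ^ 2 = wt x := sq_sqrt (wt_pos x).le
  have h3 : ‖x‖ ^ 2 ≤ (‖y‖ + √(wt x) / 2) ^ 2 := pow_le_pow_left₀ (norm_nonneg _) h1 2
  have h4 : wt x = 1 + ‖x‖ ^ 2 := rfl
  have h5 : wt y = 1 + ‖y‖ ^ 2 := rfl
  nlinarith [sq_nonneg (‖y‖ - √(wt x) / 2)]

lemma wt_rpow_le_of_norm_sub_le {n : ℕ} {x y : E n} (h : ‖y - x‖ ≤ √(wt x) / 2) {s : ℝ}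
    (hs : 0 ≤ s) : wt y ^ (-s) ≤ 4 ^ s * wt x ^ (-s) := by
  rw [rpow_neg (wt_pos y).le, rpow_neg (wt_pos x).le, ← div_eq_mul_inv,
    le_div_iff₀ (wt_rpow_pos x s), ← div_eq_inv_mul, div_le_iff₀ (wt_rpow_pos y s),
    ← mul_rpow (by norm_num) (wt_pos y).le]
  exact rpow_le_rpow (wt_pos x).le (wt_le_four_mul_wt h) hs

lemma exists_abs_partialD_le (n : ℕ) {q : ℝ} (hq : 0 ≤ q) :
    ∃ K > 0, ∀ u : E n → ℝ, ContDiff ℝ 2 u → ∀ C > 0, (∀ x, |u x| ≤ C * wt x ^ (-q / 2)) →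
      (∀ x, |lap n u x| ≤ C * wt x ^ (-(q + 2) / 2)) → ∀ i x,
      |partialD i u x| ≤ K * C * wt x ^ (-(q + 1) / 2) := by
  refine ⟨(2 * n + 2) * 4 ^ (q / 2), by positivity, fun u hu C hC hM hF i x => ?_⟩
  have hw := wt_pos x
  have hsq : √(wt x) = wt x ^ (1 / 2 : ℝ) := sqrt_eq_rpow _
  have := abs_partialD_le_of_bounds i hu x (d := √(wt x) / 2)
    (M := C * (4 ^ (q / 2) * wt x ^ (-(q / 2))))
    (F := C * (4 ^ ((q + 2) / 2) * wt x ^ (-((q + 2) / 2)))) (by positivity) (by positivity)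
    (fun y hy => (hM y).trans (mul_le_mul_of_nonneg_left (by
      rw [neg_div]; exact wt_rpow_le_of_norm_sub_le hy (by positivity)) hC.le))
    (fun y hy => (hF y).trans (mul_le_mul_of_nonneg_left (by
      rw [neg_div]; exact wt_rpow_le_of_norm_sub_le hy (by positivity)) hC.le))
  refine this.trans_eq ?_
  have e1 : wt x ^ (-(q / 2)) = wt x ^ (-(q + 1) / 2) * wt x ^ (1 / 2 : ℝ) := by
    rw [← rpow_add hw]; ring_nf
  have e2 : wt x ^ (-(q + 1) / 2) = wt x ^ (-((q + 2) / 2)) * wt x ^ (1 / 2 : ℝ) := by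
    rw [← rpow_add hw]; ring_nf
  have e3 : (4 : ℝ) ^ ((q + 2) / 2) = 4 ^ (q / 2) * 4 := by
    rw [show (q + 2) / 2 = q / 2 + 1 by ring, rpow_add_one (by norm_num)]
  have e4 : wt x ^ (1 / 2 : ℝ) ≠ 0 := (wt_rpow_pos _ _).ne'
  rw [hsq, e3, e1, e2]
  field_simp
  ring

lemma exists_symBound_of_abs_le (n N : ℕ) : ∀ q : ℝ, 0 ≤ q →
    ∃ K > 0, ∀ u : E n → ℝ, ContDiff ℝ ∞ u → ∀ C > 0, (∀ x, |u x| ≤ C * wt x ^ (-q / 2)) →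
      SymBound N (q + 2) C (lap n u) → SymBound N q (K * C) u := by
  induction N with
  | zero =>
    intro q hq
    exact ⟨1, one_pos, fun u hu C hC h _ => symBound_zero (by simpa using h)⟩
  | succ N ih =>
    intro q hq
    obtain ⟨K₁, hK₁, h₁⟩ := exists_abs_partialD_le n hq
    obtain ⟨K₂, hK₂, h₂⟩ := ih (q + 1) (by linarith)
    have hp : 0 < max K₁ 1 := lt_max_of_lt_left hK₁
    refine ⟨(n + 1) * max 1 (K₂ * max K₁ 1), by positivity, fun u hu C hC h hl => ?_⟩
    rw [mul_assoc]
    refine symBound_succ_of_partialD hu ((symBound_zero h).mono_const ?_) fun i => ?_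
    · exact le_mul_of_one_le_left hC.le (le_max_left _ _)
    have hi := h₂ (partialD i u) (contDiff_partialD i hu) (max K₁ 1 * C) (by positivity)
      (fun x => (h₁ u (contDiff_infty.1 hu 2) C hC h (fun x => hl.norm_le x) i x).trans
        (mul_le_mul_of_nonneg_right (mul_le_mul_of_nonneg_right (le_max_left _ _) hC.le)
          (wt_rpow_pos _ _).le)) ?_
    · refine hi.mono_const ?_
      rw [← mul_assoc]
      exact mul_le_mul_of_nonneg_right (le_max_right _ _) hC.le
    · rw [show lap n (partialD i u) = partialD i (lap n u) from funext fun x => lap_partialD i hu x,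
        show q + 1 + 2 = q + 2 + 1 by ring]
      exact (hl.partialD (contDiff_lap hu) i).mono_const
        (le_mul_of_one_le_left hC.le (le_max_right _ _))

/-- A priori estimate for solutions of the Poisson equation vanishing at infinity. -/
lemma exists_symBound_of_lap {n : ℕ} (N : ℕ) {q : ℝ} (hq : 0 < q) (hqn : q < n - 2) :
    ∃ K > 0, ∀ u : E n → ℝ, ContDiff ℝ ∞ u → Tendsto u (cocompact (E n)) (𝓝 0) → ∀ C > 0,
      SymBound N (q + 2) C (lap n u) → SymBound N q (K * C) u := by
  obtain ⟨K₁, hK₁, h₁⟩ := exists_abs_le_of_abs_lap_le hq hqn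
  obtain ⟨K₂, hK₂, h₂⟩ := exists_symBound_of_abs_le n N q hq.le
  have hp : 0 < max K₁ 1 := lt_max_of_lt_left hK₁
  refine ⟨K₂ * max K₁ 1, by positivity, fun u hu hlim C hC h => ?_⟩
  rw [mul_assoc]
  refine h₂ u hu _ (by positivity) (fun x => ?_)
    (h.mono_const (le_mul_of_one_le_left hC.le (le_max_right _ _)))
  refine (h₁ u (contDiff_infty.1 hu 2) hlim C hC (fun x => h.norm_le x) x).trans ?_
  exact mul_le_mul_of_nonneg_right (mul_le_mul_of_nonneg_right (le_max_left _ _) hC.le)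
    (wt_rpow_pos _ _).le

/-- Multiplication by the Fourier symbol of the `i`-th partial derivative. -/
def fourierCoordMul {n : ℕ} (i : Fin n) (h : E n → ℂ) (ξ : E n) : ℂ :=
  -(2 * π * Complex.I) * (ξ i * h ξ)

lemma norm_fourierCoordMul_le {n : ℕ} (i : Fin n) (h : E n → ℂ) (ξ : E n) :
    ‖fourierCoordMul i h ξ‖ ≤ 2 * π * (‖ξ‖ * ‖h ξ‖) := by
  have : ‖fourierCoordMul i h ξ‖ = 2 * π * (‖ξ i‖ * ‖h ξ‖) := by
    simp [fourierCoordMul, abs_of_pos pi_pos]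
  rw [this]
  gcongr
  exact PiLp.norm_apply_le ξ i

lemma integrable_pow_mul_fourierCoordMul {n : ℕ} (i : Fin n) {h : E n → ℂ}
    (hm : AEStronglyMeasurable h) {k : ℕ} (hk : Integrable fun ξ => ‖ξ‖ ^ (k + 1) * ‖h ξ‖) :
    Integrable fun ξ => ‖ξ‖ ^ k * ‖fourierCoordMul i h ξ‖ := by
  refine (hk.const_mul (2 * π)).mono' ?_ (Eventually.of_forall fun ξ => ?_)
  · have h1 : Continuous fun ξ : E n => (ξ i : ℂ) :=
      Complex.continuous_ofReal.comp (contDiff_coord i (k := 0)).continuous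
    exact (continuous_norm.pow k).aestronglyMeasurable.mul
      ((h1.aestronglyMeasurable.mul hm).const_mul _).norm
  · rw [norm_of_nonneg (by positivity)]
    calc ‖ξ‖ ^ k * ‖fourierCoordMul i h ξ‖ ≤ ‖ξ‖ ^ k * (2 * π * (‖ξ‖ * ‖h ξ‖)) := by
          gcongr; exact norm_fourierCoordMul_le i h ξ
      _ = 2 * π * (‖ξ‖ ^ (k + 1) * ‖h ξ‖) := by ring

lemma aestronglyMeasurable_fourierCoordMul {n : ℕ} (i : Fin n) {h : E n → ℂ}
    (hm : AEStronglyMeasurable h) : AEStronglyMeasurable (fourierCoordMul i h) := by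
  have h1 : Continuous fun ξ : E n => (ξ i : ℂ) :=
    Complex.continuous_ofReal.comp (contDiff_coord i (k := 0)).continuous
  exact (h1.aestronglyMeasurable.mul hm).const_mul _

lemma integrable_of_pow_zero {n : ℕ} {h : E n → ℂ} (hm : AEStronglyMeasurable h)
    (h0 : Integrable fun ξ => ‖ξ‖ ^ 0 * ‖h ξ‖) : Integrable h :=
  (integrable_norm_iff hm).1 (by simpa using h0)

lemma partialD_re_fourier {n : ℕ} (i : Fin n) {h : E n → ℂ} (hm : AEStronglyMeasurable h)
    (h0 : Integrable h) (h1 : Integrable fun ξ => ‖ξ‖ * ‖h ξ‖) (x : E n) :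
    partialD i (fun x => (𝓕 h x).re) x = (𝓕 (fourierCoordMul i h) x).re := by
  have hd := Real.hasFDerivAt_fourier h0 h1 x
  refine (HasFDerivAt.partialD_eq (f := fun x => (𝓕 h x).re)
    (Complex.reCLM.hasFDerivAt.comp x hd)).trans ?_
  have hInt : Integrable (VectorFourier.fourierSMulRight (innerSL ℝ) h) := by
    refine (h1.const_mul (2 * π)).mono' hm.fourierSMulRight
      (Eventually.of_forall fun ξ => ?_)
    refine (VectorFourier.norm_fourierSMulRight_le _ _ _).trans ?_
    have := norm_innerSL_le ℝ (E := E n)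
    calc 2 * π * ‖innerSL ℝ (E := E n)‖ * ‖ξ‖ * ‖h ξ‖ ≤ 2 * π * 1 * ‖ξ‖ * ‖h ξ‖ := by gcongr
      _ = _ := by ring
  rw [ContinuousLinearMap.comp_apply, Real.fourier_continuousLinearMap_apply hInt]
  have : (fun ξ => VectorFourier.fourierSMulRight (innerSL ℝ) h ξ (basisVec i))
      = fourierCoordMul i h := by
    funext ξ
    have h2 : innerSL ℝ ξ (EuclideanSpace.single i 1) = ξ i := by
      rw [innerSL_apply_apply, EuclideanSpace.inner_single_right]; simp
    simp [fourierCoordMul, basisVec, h2]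
  rw [this]
  rfl

lemma lap_re_fourier {n : ℕ} {h : E n → ℂ} (hm : AEStronglyMeasurable h)
    (hi : ∀ k : ℕ, Integrable fun ξ => ‖ξ‖ ^ k * ‖h ξ‖) (x : E n) :
    lap n (fun x => (𝓕 h x).re) x
      = (𝓕 (fun ξ => -(4 * π ^ 2 * ‖ξ‖ ^ 2 : ℝ) * h ξ) x).re := by
  have hm1 : ∀ i, AEStronglyMeasurable (fourierCoordMul i h) := fun i =>
    aestronglyMeasurable_fourierCoordMul i hm
  have hi1 : ∀ i (k : ℕ), Integrable fun ξ => ‖ξ‖ ^ k * ‖fourierCoordMul i h ξ‖ := fun i k =>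
    integrable_pow_mul_fourierCoordMul i hm (hi (k + 1))
  have hi2 : ∀ i, Integrable (fourierCoordMul i (fourierCoordMul i h)) := fun i =>
    integrable_of_pow_zero (aestronglyMeasurable_fourierCoordMul i (hm1 i))
      (integrable_pow_mul_fourierCoordMul i (hm1 i) (hi1 i 1))
  rw [lap_eq_sum]
  have : ∀ i, partialD i (partialD i fun x => (𝓕 h x).re) x
      = (𝓕 (fourierCoordMul i (fourierCoordMul i h)) x).re := fun i => by
    rw [partialD_congr (Eventually.of_forall fun y => partialD_re_fourier i hm
        (integrable_of_pow_zero hm (hi 0)) (by simpa using hi 1) y),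
      partialD_re_fourier i (hm1 i) (integrable_of_pow_zero (hm1 i) (hi1 i 0))
        (by simpa using hi1 i 1)]
  rw [Finset.sum_congr rfl fun i _ => this i, ← Complex.re_sum]
  congr 1
  simp only [Real.fourier_eq]
  rw [← integral_finsetSum _ fun i _ => (Real.fourierIntegral_convergent_iff x).2 (hi2 i)]
  congr 1
  funext ξ
  rw [← Finset.smul_sum]
  congr 1
  have hI : (2 * π * Complex.I) ^ 2 = -(4 * π ^ 2) := by
    rw [mul_pow, Complex.I_sq]; ring
  have hterm : ∀ i, fourierCoordMul i (fourierCoordMul i h) ξ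
      = -(4 * π ^ 2) * h ξ * ((ξ i ^ 2 : ℝ) : ℂ) := fun i => by
    simp only [fourierCoordMul]
    rw [← hI]
    push_cast
    ring
  rw [Finset.sum_congr rfl fun i _ => hterm i, ← Finset.mul_sum, ← Complex.ofReal_sum,
    sum_coord_sq]
  push_cast
  ring

lemma integrable_pow_mul_div_norm_sq {n : ℕ} (hn : 3 ≤ n) (h : SchwartzMap (E n) ℂ) (k : ℕ) :
    Integrable fun ξ : E n => ‖ξ‖ ^ k * ‖((-(4 * π ^ 2 * ‖ξ‖ ^ 2)⁻¹ : ℝ) : ℂ) * h ξ‖ := by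
  obtain ⟨M, hM0, hM⟩ := h.decay 0 0
  simp only [pow_zero, one_mul, norm_iteratedFDeriv_zero] at hM
  have hball : Integrable ((Metric.ball (0 : E n) 1).indicator fun ξ => M * (‖ξ‖ ^ 2)⁻¹) := by
    have h1 : IntegrableOn (fun ξ : E n => (fun r : ℝ => (r ^ 2)⁻¹) ‖ξ‖) (Metric.ball 0 1) := by
      have : Nontrivial (E n) := by
        have : Nonempty (Fin n) := ⟨⟨0, by omega⟩⟩
        infer_instance
      refine (integrableOn_fun_norm_addHaar volume (f := fun r : ℝ => (r ^ 2)⁻¹)).2 ?_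
      have h2 : IntegrableOn (fun y : ℝ => y ^ (n - 3)) (Ioo 0 1) :=
        ((continuous_pow _).integrableOn_Icc (a := 0) (b := 1)).mono_set Ioo_subset_Icc_self
      refine h2.congr_fun (fun y hy => ?_) measurableSet_Ioo
      have hy0 : y ≠ 0 := hy.1.ne'
      rw [finrank_euclideanSpace_fin, smul_eq_mul, show n - 1 = n - 3 + 2 by omega, pow_add]
      field_simp
    exact (integrable_indicator_iff measurableSet_ball).2 (h1.const_mul M)
  refine (hball.add (h.integrable_pow_mul volume k)).mono' ?_ (Eventually.of_forall fun ξ => ?_)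
  · have hmeas : Measurable fun ξ : E n => -((4 * π ^ 2 * ‖ξ‖ ^ 2)⁻¹ : ℝ) := by fun_prop
    exact (continuous_norm.pow k).aestronglyMeasurable.mul
      ((Complex.measurable_ofReal.comp hmeas).aestronglyMeasurable.mul
        h.continuous.aestronglyMeasurable).norm
  · rw [norm_of_nonneg (by positivity)]
    have h1 : ‖((-(4 * π ^ 2 * ‖ξ‖ ^ 2)⁻¹ : ℝ) : ℂ) * h ξ‖ ≤ (‖ξ‖ ^ 2)⁻¹ * ‖h ξ‖ := by
      rw [norm_mul, Complex.norm_real, norm_neg, norm_of_nonneg (by positivity), mul_inv]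
      refine mul_le_mul_of_nonneg_right (mul_le_of_le_one_left (by positivity) ?_) (norm_nonneg _)
      exact inv_le_one_of_one_le₀ (by nlinarith [pi_gt_three])
    simp only [Pi.add_apply]
    by_cases hξ : ‖ξ‖ < 1
    · rw [indicator_of_mem (by simpa using hξ)]
      have h2 : ‖ξ‖ ^ k ≤ 1 := pow_le_one₀ (norm_nonneg _) hξ.le
      calc _ ≤ 1 * ((‖ξ‖ ^ 2)⁻¹ * M) := by
            refine mul_le_mul h2 (h1.trans ?_) (norm_nonneg _) zero_le_one
            exact mul_le_mul_of_nonneg_left (hM ξ) (by positivity)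
        _ ≤ _ := by rw [one_mul, mul_comm]; exact le_add_of_nonneg_right (by positivity)
    · rw [indicator_of_notMem (by simpa using hξ), zero_add]
      refine mul_le_mul_of_nonneg_left (h1.trans ?_) (by positivity)
      exact mul_le_of_le_one_left (norm_nonneg _)
        (inv_le_one_of_one_le₀ (one_le_pow₀ (not_lt.1 hξ)))

/-- Solvability of the Poisson equation for compactly supported data, with solutions vanishing at
infinity. -/
lemma exists_lap_eq_of_hasCompactSupport {n : ℕ} (hn : 3 ≤ n) {g : E n → ℝ} (hg : ContDiff ℝ ∞ g)
    (hs : HasCompactSupport g) :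
    ∃ v : E n → ℝ, ContDiff ℝ ∞ v ∧ (∀ x, lap n v x = g x) ∧
      Tendsto v (cocompact (E n)) (𝓝 0) := by
  have hgC : ContDiff ℝ ∞ fun x => (g x : ℂ) := Complex.ofRealCLM.contDiff.comp hg
  have hsC : HasCompactSupport fun x => (g x : ℂ) := hs.comp_left Complex.ofReal_zero
  set gS : SchwartzMap (E n) ℂ := hsC.toSchwartzMap hgC
  set h : SchwartzMap (E n) ℂ := 𝓕⁻ gS
  have hF : 𝓕 (h : E n → ℂ) = fun x => (g x : ℂ) := by
    have : 𝓕 h = gS := FourierTransform.fourier_fourierInv_eq gS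
    rw [← SchwartzMap.fourier_coe, this]
    rfl
  set m : E n → ℂ := fun ξ => ((-(4 * π ^ 2 * ‖ξ‖ ^ 2)⁻¹ : ℝ) : ℂ) * h ξ
  have hi : ∀ k : ℕ, Integrable fun ξ => ‖ξ‖ ^ k * ‖m ξ‖ := integrable_pow_mul_div_norm_sq hn h
  have hm : AEStronglyMeasurable m := by
    have hmeas : Measurable fun ξ : E n => -((4 * π ^ 2 * ‖ξ‖ ^ 2)⁻¹ : ℝ) := by fun_prop
    exact ((Complex.measurable_ofReal.comp hmeas).aestronglyMeasurable.mul
        h.continuous.aestronglyMeasurable)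
  refine ⟨fun x => (𝓕 m x).re, ?_, fun x => ?_, ?_⟩
  · exact Complex.reCLM.contDiff.comp (Real.contDiff_fourier fun k _ => hi k)
  · rw [lap_re_fourier hm hi, ← Complex.ofReal_re (g x)]
    congr 1
    rw [← congrFun hF x, Real.fourier_eq, Real.fourier_eq]
    refine integral_congr_ae ?_
    have : Nontrivial (E n) := by
      have : Nonempty (Fin n) := ⟨⟨0, by omega⟩⟩
      infer_instance
    filter_upwards [compl_mem_ae_iff.2 (measure_singleton (0 : E n))] with ξ hξ
    have hξ0 : (‖ξ‖ : ℂ) ≠ 0 := by simpa using hξ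
    have hpi : (π : ℂ) ≠ 0 := by simp [pi_ne_zero]
    congr 1
    simp only [m]
    push_cast
    field_simp
  · have h1 : Tendsto (𝓕 m) (cocompact (E n)) (𝓝 0) := by
      have := tendsto_integral_exp_inner_smul_cocompact m
      refine this.congr fun x => ?_
      rw [Real.fourier_eq]
    exact (Complex.continuous_re.tendsto 0).comp h1

section Symbols

variable {F : Type*} [NormedAddCommGroup F] [NormedSpace ℝ F]

lemma isSymbol_of_forall {n : ℕ} {q : ℝ} {f : E n → F} (hf : ContDiff ℝ ∞ f)
    (h : ∀ j : ℕ, ∃ C : ℝ, ∀ x, ‖iteratedFDeriv ℝ j f x‖ ≤ C * wt x ^ (-(q + j) / 2)) :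
    IsSymbol q f := by
  refine ⟨hf, fun N => ?_⟩
  choose C hC using h
  refine ⟨∑ j ∈ Finset.range (N + 1), |C j|, fun j hj x => (hC j x).trans ?_⟩
  refine mul_le_mul_of_nonneg_right ((le_abs_self _).trans ?_) (wt_rpow_pos x _).le
  exact Finset.single_le_sum (f := fun j => |C j|) (fun i _ => abs_nonneg _)
    (Finset.mem_range.2 (by omega))

lemma isSymbol_of_hasCompactSupport {n : ℕ} (q : ℝ) {f : E n → F} (hf : ContDiff ℝ ∞ f)
    (hs : HasCompactSupport f) : IsSymbol q f := by
  refine isSymbol_of_forall hf fun j => ?_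
  have hc : Continuous fun x => wt x ^ ((q + j) / 2) * ‖iteratedFDeriv ℝ j f x‖ :=
    ((contDiff_wt (k := 0)).continuous.rpow_const fun x => Or.inl (wt_pos x).ne').mul
      (hf.continuous_iteratedFDeriv (by exact_mod_cast le_top)).norm
  have hcs : HasCompactSupport fun x => wt x ^ ((q + j) / 2) * ‖iteratedFDeriv ℝ j f x‖ :=
    HasCompactSupport.mul_left (hs.iteratedFDeriv (𝕜 := ℝ) j).norm
  obtain ⟨x₀, hx₀⟩ := hc.exists_forall_ge_of_hasCompactSupport hcs
  refine ⟨wt x₀ ^ ((q + j) / 2) * ‖iteratedFDeriv ℝ j f x₀‖, fun x => ?_⟩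
  rw [neg_div, rpow_neg (wt_pos x).le, ← div_eq_mul_inv, le_div_iff₀ (wt_rpow_pos x _), mul_comm]
  exact hx₀ x

end Symbols

lemma rpow_le_rpow_abs {t M : ℝ} (ht : 1 ≤ t) (htM : t ≤ M) (s : ℝ) : t ^ s ≤ M ^ |s| :=
  (rpow_le_rpow_of_exponent_le ht (le_abs_self s)).trans
    (rpow_le_rpow (by linarith) htM (abs_nonneg s))

lemma exists_symBound_dilation {n : ℕ} {ψ : E n → ℝ} (hψ : ContDiff ℝ ∞ ψ)
    (hs : tsupport ψ ⊆ {y | 1 ≤ ‖y‖ ∧ ‖y‖ ≤ 4}) (η : ℝ) (N : ℕ) :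
    ∃ C, 0 ≤ C ∧ ∀ l : ℝ, 0 < l → l ≤ 1 → SymBound N (-η) (C * l ^ η) (fun x => ψ (l • x)) := by
  have hcs : HasCompactSupport ψ :=
    HasCompactSupport.of_support_subset_isCompact (isCompact_closedBall (0 : E n) 4)
      ((subset_tsupport ψ).trans fun y hy => by simpa using (hs hy).2)
  have hM : ∀ j : ℕ, ∃ M, ∀ y, ‖iteratedFDeriv ℝ j ψ y‖ ≤ M := fun j =>
    (hcs.iteratedFDeriv (𝕜 := ℝ) j).exists_bound_of_continuous
      (hψ.continuous_iteratedFDeriv (by exact_mod_cast le_top))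
  choose M hM using hM
  have hM0 : ∀ j, 0 ≤ M j := fun j => (norm_nonneg _).trans (hM j 0)
  have hterm : ∀ j, 0 ≤ M j * (17 : ℝ) ^ |((j : ℝ) - η) / 2| := fun j =>
    mul_nonneg (hM0 j) (by positivity)
  refine ⟨∑ j ∈ Finset.range (N + 1), M j * (17 : ℝ) ^ |((j : ℝ) - η) / 2|,
    Finset.sum_nonneg fun j _ => hterm j, fun l hl0 hl1 j hj x => ?_⟩
  have hw := wt_pos x
  refine le_trans ?_ (mul_le_mul_of_nonneg_right (mul_le_mul_of_nonneg_right
    (Finset.single_le_sum (fun j _ => hterm j) (Finset.mem_range.2 (Nat.lt_succ_of_le hj)))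
    (rpow_pos_of_pos hl0 η).le) (wt_rpow_pos x _).le)
  rw [iteratedFDeriv_comp_const_smul l (hψ.of_le (by exact_mod_cast le_top))]
  by_cases h0 : iteratedFDeriv ℝ j ψ (l • x) = 0
  · simp only [h0, smul_zero, norm_zero]
    exact mul_nonneg (mul_nonneg (hterm j) (rpow_pos_of_pos hl0 η).le) (wt_rpow_pos x _).le
  obtain ⟨h1, h4⟩ := hs (support_iteratedFDeriv_subset (𝕜 := ℝ) j (Function.mem_support.2 h0))
  rw [norm_smul, norm_eq_abs, abs_of_pos hl0] at h1 h4
  have e : l ^ 2 * wt x = l ^ 2 + (l * ‖x‖) ^ 2 := by simp only [wt]; ring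
  have hb := rpow_le_rpow_abs (t := l ^ 2 * wt x) (M := 17) (by rw [e]; nlinarith)
    (by rw [e]; nlinarith) (((j : ℝ) - η) / 2)
  have hl : l ^ j = l ^ η * (l ^ 2 * wt x) ^ (((j : ℝ) - η) / 2) * wt x ^ (-(-η + j) / 2) := by
    rw [mul_rpow (by positivity) hw.le, ← rpow_natCast l 2, ← rpow_mul hl0.le, mul_assoc,
      mul_assoc, ← rpow_add hw, ← mul_assoc, ← rpow_add hl0, ← rpow_natCast]
    rw [show ((j : ℝ) - η) / 2 + -(-η + j) / 2 = 0 by ring, rpow_zero, mul_one]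
    push_cast
    ring_nf
  rw [norm_smul, norm_eq_abs, abs_of_pos (pow_pos hl0 j), hl]
  have h2 := hM j (l • x)
  calc _ ≤ l ^ η * 17 ^ |((j : ℝ) - η) / 2| * wt x ^ (-(-η + j) / 2) * M j := by gcongr
    _ = _ := by ring

lemma iteratedFDeriv_two_basisVec {n : ℕ} {f : E n → ℝ} (hf : ContDiff ℝ ∞ f) (x : E n) :
    lap n f x = ∑ i, iteratedFDeriv ℝ 2 f x ![basisVec i, basisVec i] := by
  unfold lap
  refine Finset.sum_congr rfl fun i _ => ?_
  rw [iteratedFDeriv_two_apply]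
  have h : DifferentiableAt ℝ (fderiv ℝ f) x :=
    (hf.fderiv_right (m := ∞) (by simp)).differentiable (by simp) x
  have := (h.hasFDerivAt.clm_apply (hasFDerivAt_const (basisVec i : E n) x)).fderiv
  rw [show (fun y => fderiv ℝ f y (EuclideanSpace.single i 1)) =
    fun y => fderiv ℝ f y (basisVec i) from rfl, this]
  simp [basisVec]

lemma symBound_tsum {n : ℕ} {q : ℝ} (hq : 0 ≤ q) {v : ℕ → E n → ℝ}
    (hv : ∀ k, ContDiff ℝ ∞ (v k))
    (h : ∀ N : ℕ, ∃ a : ℕ → ℝ, Summable a ∧ ∀ k, SymBound N q (a k) (v k)) :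
    ContDiff ℝ ∞ (fun x => ∑' k, v k x) ∧ (∃ C, SymBound 0 q C (fun x => ∑' k, v k x)) ∧
      ∀ x, HasSum (fun k => lap n (v k) x) (lap n (fun x => ∑' k, v k x) x) := by
  choose a ha hb using h
  have hbound : ∀ (j k : ℕ) (x : E n), (j : ℕ∞) ≤ (⊤ : ℕ∞) →
      ‖iteratedFDeriv ℝ j (v k) x‖ ≤ a j k := fun j k x _ =>
    (hb j k j le_rfl x).trans (mul_le_of_le_one_right (hb j k).nonneg
      (rpow_le_one_of_one_le_of_nonpos (one_le_wt x) (by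
        have : (0 : ℝ) ≤ j := Nat.cast_nonneg j
        linarith)))
  have hV : ContDiff ℝ ∞ (fun x => ∑' k, v k x) :=
    contDiff_tsum hv (fun j _ => ha j) hbound
  refine ⟨hV, ⟨∑' k, a 0 k, symBound_zero fun x => ?_⟩, fun x => ?_⟩
  · rw [← tsum_mul_right]
    exact tsum_of_norm_bounded ((ha 0).mul_right _).hasSum fun k => (hb 0 k).norm_le x
  · have e : iteratedFDeriv ℝ 2 (fun x => ∑' k, v k x) x = ∑' k, iteratedFDeriv ℝ 2 (v k) x :=
      iteratedFDeriv_tsum_apply hv (fun j _ => ha j) hbound (by exact_mod_cast le_top) x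
    have hs : Summable fun k => iteratedFDeriv ℝ 2 (v k) x :=
      .of_norm_bounded (ha 2) fun k => hbound 2 k x le_top
    have h2 : HasSum (fun k => iteratedFDeriv ℝ 2 (v k) x)
        (iteratedFDeriv ℝ 2 (fun x => ∑' k, v k x) x) := e ▸ hs.hasSum
    rw [iteratedFDeriv_two_basisVec hV]
    simp_rw [iteratedFDeriv_two_basisVec (hv _)]
    exact hasSum_sum fun i _ => h2.mapL
      (ContinuousMultilinearMap.apply ℝ (fun _ : Fin 2 => E n) ℝ ![basisVec i, basisVec i])

lemma exists_smooth_cutoff (n : ℕ) {a b : ℝ} (ha : 0 < a) (hab : a < b) :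
    ∃ χ : E n → ℝ, ContDiff ℝ ∞ χ ∧ (∀ x, ‖x‖ ≤ a → χ x = 1) ∧ ∀ x, b ≤ ‖x‖ → χ x = 0 := by
  let χ : ContDiffBump (0 : E n) := ⟨a, b, ha, hab⟩
  exact ⟨χ, χ.contDiff, fun x hx => χ.one_of_mem_closedBall (by simpa using hx),
    fun x hx => χ.zero_of_le_dist (by simpa using hx)⟩

lemma hasCompactSupport_of_norm_le {n : ℕ} {f : E n → ℝ} {b : ℝ}
    (hf : ∀ x, b ≤ ‖x‖ → f x = 0) : HasCompactSupport f :=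
  HasCompactSupport.of_support_subset_isCompact (isCompact_closedBall (0 : E n) b) fun x hx => by
    by_contra h
    exact hx (hf x (by simpa using (not_le.1 (by simpa using h)).le))

lemma SymBound.tendsto_zero {n : ℕ} {q C : ℝ} (hq : 0 < q) {f : E n → ℝ}
    (h : SymBound 0 q C f) : Tendsto f (cocompact (E n)) (𝓝 0) := by
  have h1 := (tendsto_wt_rpow_neg (n := n) (s := -q / 2) (by linarith)).const_mul C
  rw [mul_zero] at h1
  exact squeeze_zero_norm h.norm_le h1

lemma exists_isSymbol_lap_eq_of_lt {n : ℕ} (hn : 3 ≤ n) {q : ℝ} (hq : 0 < q) (hqn : q < n - 2)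
    {G : E n → ℝ} (hG : IsSymbol (q + 2) G) :
    ∃ V, IsSymbol q V ∧ ∀ x, lap n V x = G x := by
  obtain ⟨χ, hχ, hχ1, hχ0⟩ := exists_smooth_cutoff n one_pos one_lt_two
  set ψ : E n → ℝ := fun x => χ ((2 : ℝ)⁻¹ • x) - χ x with hψdef
  have hψ : ContDiff ℝ ∞ ψ := (hχ.comp (contDiff_const_smul _)).sub hχ
  have hψs : tsupport ψ ⊆ {y | 1 ≤ ‖y‖ ∧ ‖y‖ ≤ 4} := by
    refine closure_minimal (fun y hy => ?_) ((isClosed_le continuous_const continuous_norm).inter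
      (isClosed_le continuous_norm continuous_const))
    by_contra hc
    refine hy ?_
    have e : ‖(2 : ℝ)⁻¹ • y‖ = ‖y‖ / 2 := by rw [norm_smul]; norm_num; ring
    rcases not_and_or.1 hc with h | h
    · have h := not_le.1 h
      simp [hψdef, hχ1 y h.le, hχ1 ((2 : ℝ)⁻¹ • y) (by rw [e]; linarith [norm_nonneg y])]
    · have h := not_le.1 h
      simp [hψdef, hχ0 y (by linarith), hχ0 ((2 : ℝ)⁻¹ • y) (by rw [e]; linarith)]
  set l : ℕ → ℝ := fun k => (2⁻¹ : ℝ) ^ k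
  have hl0 : ∀ k, 0 < l k := fun k => by positivity
  have hl1 : ∀ k, l k ≤ 1 := fun k => pow_le_one₀ (by norm_num) (by norm_num)
  set η := q / 2
  have hη : 0 < η := by simp only [η]; linarith
  have hlsum : Summable fun k => l k ^ η := by
    have h : (fun k => l k ^ η) = fun k => ((2⁻¹ : ℝ) ^ η) ^ k := by
      funext k
      rw [← rpow_natCast, ← rpow_mul (by norm_num), mul_comm, rpow_mul (by norm_num), rpow_natCast]
    rw [h]
    exact summable_geometric_of_lt_one (by positivity)
      (rpow_lt_one (by norm_num) (by norm_num) hη)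
  set g : ℕ → E n → ℝ := fun k => Nat.casesOn k (fun x => χ x * G x)
    (fun k x => ψ (l k • x) * G x) with hg
  have hgsmooth : ∀ k, ContDiff ℝ ∞ (g k) := by
    rintro (_ | k)
    · exact hχ.mul hG.1
    · exact (hψ.comp (contDiff_const_smul _)).mul hG.1
  have hgsupp : ∀ k, HasCompactSupport (g k) := by
    rintro (_ | k)
    · exact hasCompactSupport_of_norm_le (b := 2) fun x hx => by simp [hg, hχ0 x hx]
    · refine hasCompactSupport_of_norm_le (b := 5 / l k) fun x hx => ?_
      have h : ψ (l k • x) = 0 := by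
        refine image_eq_zero_of_notMem_tsupport fun h => ?_
        have h4 := (hψs h).2
        rw [norm_smul, norm_eq_abs, abs_of_pos (hl0 k)] at h4
        rw [div_le_iff₀ (hl0 k)] at hx
        linarith
      simp [hg, h]
  have hgb : ∀ N : ℕ, ∃ a : ℕ → ℝ, Summable a ∧ (∀ k, 0 < a k) ∧
      ∀ k, SymBound N (η + 2) (a k) (g k) := by
    intro N
    obtain ⟨C, hC0, hC⟩ := exists_symBound_dilation hψ hψs η N
    obtain ⟨D, hD⟩ := hG.2 N
    obtain ⟨D₀, hD₀⟩ := (isSymbol_of_hasCompactSupport (η + 2) (hgsmooth 0) (hgsupp 0)).2 N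
    have hD₀' := hD₀.nonneg
    have hDn := hD.nonneg
    refine ⟨fun k => Nat.casesOn k (D₀ + 1) fun k => (2 ^ N * C * D + 1) * l k ^ η,
      (summable_nat_add_iff 1).1 (hlsum.mul_left _), ?_, ?_⟩
    · rintro (_ | k)
      · exact (by linarith : 0 < D₀ + 1)
      · exact mul_pos (by positivity) (rpow_pos_of_pos (hl0 k) _)
    · rintro (_ | k)
      · exact hD₀.mono_const (by linarith : D₀ ≤ D₀ + 1)
      · have h := (hC (l k) (hl0 k) (hl1 k)).mul hD (hψ.comp (contDiff_const_smul _)) hG.1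
        rw [show -η + (q + 2) = η + 2 by simp only [η]; ring] at h
        refine h.mono_const ?_
        have := (rpow_pos_of_pos (hl0 k) η).le
        simp only
        nlinarith
  choose v hv hvlap hvlim using fun k => exists_lap_eq_of_hasCompactSupport hn (hgsmooth k)
    (hgsupp k)
  have hvb : ∀ N : ℕ, ∃ a : ℕ → ℝ, Summable a ∧ ∀ k, SymBound N η (a k) (v k) := by
    intro N
    obtain ⟨a, ha, ha0, hab⟩ := hgb N
    obtain ⟨K, -, hK⟩ := exists_symBound_of_lap (n := n) N (q := η) hη (by simp only [η]; linarith)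
    refine ⟨fun k => K * a k, ha.mul_left K, fun k => hK _ (hv k) (hvlim k) _ (ha0 k) ?_⟩
    rw [funext (hvlap k)]
    exact hab k
  obtain ⟨hV, ⟨C, hC⟩, hlap⟩ := symBound_tsum hη.le hv hvb
  set V : E n → ℝ := fun x => ∑' k, v k x
  have hVlap : ∀ x, lap n V x = G x := by
    intro x
    have h1 := (hlap x).tendsto_sum_nat
    have hpart : ∀ K, ∑ k ∈ Finset.range (K + 1), lap n (v k) x = χ (l K • x) * G x := by
      intro K
      induction K with
      | zero => simp [hvlap, hg, l]
      | succ K ih =>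
        rw [Finset.sum_range_succ, ih, hvlap]
        simp only [hg, hψdef, smul_smul]
        rw [show (2 : ℝ)⁻¹ * l K = l (K + 1) by simp only [l]; ring]
        ring
    have h2 : Tendsto (fun K => l K • x) atTop (𝓝 0) := by
      have := (tendsto_pow_atTop_nhds_zero_of_lt_one (r := (2⁻¹ : ℝ)) (by norm_num)
        (by norm_num)).smul_const x
      rwa [zero_smul] at this
    have h3 : ∀ᶠ K in atTop, ∑ k ∈ Finset.range (K + 1), lap n (v k) x = G x := by
      filter_upwards [h2 (Metric.closedBall_mem_nhds 0 one_pos)] with K hK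
      rw [hpart, hχ1 _ (by simpa using hK), one_mul]
    exact tendsto_nhds_unique ((tendsto_add_atTop_iff_nat 1).2 h1)
      (tendsto_const_nhds.congr' (h3.mono fun _ h => h.symm))
  refine ⟨V, ⟨hV, fun N => ?_⟩, hVlap⟩
  obtain ⟨K, -, hK⟩ := exists_symBound_of_lap (n := n) N hq hqn
  obtain ⟨D, hD⟩ := hG.2 N
  have hD0 := hD.nonneg
  refine ⟨_, hK V hV (hC.tendsto_zero hη) (D + 1) (by linarith) ?_⟩
  rw [funext hVlap]
  exact hD.mono_const (by linarith)

lemma wt_rpow_le_norm_rpow {n : ℕ} {x : E n} {s : ℝ} (hx : 0 < ‖x‖) (hs : s ≤ 0) :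
    wt x ^ (s / 2) ≤ ‖x‖ ^ s := by
  have h : ‖x‖ ^ s = (‖x‖ ^ 2) ^ (s / 2) := by
    rw [← rpow_natCast, ← rpow_mul (norm_nonneg _)]; norm_num; ring_nf
  rw [h]
  exact rpow_le_rpow_of_nonpos (by positivity) (by simp [wt]) (by linarith)

lemma norm_rpow_le_const_mul_wt_rpow {n : ℕ} {x : E n} {r : ℝ} (hr : 0 < r) (hx : r ≤ ‖x‖)
    (s : ℝ) : ‖x‖ ^ s ≤ (1 + (r ^ 2)⁻¹) ^ |-s / 2| * wt x ^ (s / 2) := by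
  have hx0 : 0 < ‖x‖ := hr.trans_le hx
  have hw := wt_pos x
  have h1 : 1 ≤ wt x / ‖x‖ ^ 2 := by rw [le_div_iff₀ (by positivity)]; simp [wt]
  have h2 : wt x / ‖x‖ ^ 2 ≤ 1 + (r ^ 2)⁻¹ := by
    have h3 : 1 ≤ (r ^ 2)⁻¹ * ‖x‖ ^ 2 := by
      rw [← div_eq_inv_mul, one_le_div (by positivity)]
      exact pow_le_pow_left₀ hr.le hx 2
    rw [div_le_iff₀ (by positivity), wt]
    nlinarith
  have h3 := rpow_le_rpow_abs h1 h2 (-s / 2)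
  have e : ‖x‖ ^ s = (wt x / ‖x‖ ^ 2) ^ (-s / 2) * wt x ^ (s / 2) := by
    rw [div_rpow hw.le (by positivity), div_mul_eq_mul_div, ← rpow_add hw,
      ← rpow_natCast, ← rpow_mul hx0.le, show -s / 2 + s / 2 = 0 by ring, rpow_zero, one_div,
      ← rpow_neg hx0.le]
    push_cast
    ring_nf
  rw [e]
  exact mul_le_mul_of_nonneg_right h3 (wt_rpow_pos x _).le

lemma exists_isSymbol_eq_of_lt_norm {n : ℕ} {ρ r q : ℝ} (hρ : 0 < ρ) (hr : ρ < r) {f : E n → ℝ}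
    (hf : ContDiffOn ℝ ∞ f {x | ρ < ‖x‖})
    (hb : ∀ j : ℕ, ∃ C : ℝ, ∀ x, r < ‖x‖ → ‖iteratedFDeriv ℝ j f x‖ ≤ C * ‖x‖ ^ (-(q + j))) :
    ∃ g, IsSymbol q g ∧ ∀ x, r ≤ ‖x‖ → g x = f x := by
  obtain ⟨χ, hχ, hχ1, hχ0⟩ := exists_smooth_cutoff n (a := (ρ + r) / 2) (b := r) (by linarith)
    (by linarith)
  have hopen : ∀ c : ℝ, IsOpen {x : E n | c < ‖x‖} := fun c =>
    isOpen_lt continuous_const continuous_norm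
  set g : E n → ℝ := fun x => (1 - χ x) * f x
  have hgf : ∀ x, r ≤ ‖x‖ → g x = f x := fun x hx => by simp [g, hχ0 x hx]
  have hg : ContDiff ℝ ∞ g := by
    refine contDiff_iff_contDiffAt.2 fun x => ?_
    by_cases hx : ρ < ‖x‖
    · exact (contDiff_const.sub hχ).contDiffAt.mul (hf.contDiffAt ((hopen ρ).mem_nhds hx))
    · refine (contDiffAt_const (c := (0 : ℝ))).congr_of_eventuallyEq ?_
      have : {y : E n | ‖y‖ < (ρ + r) / 2} ∈ 𝓝 x :=
        (isOpen_lt continuous_norm continuous_const).mem_nhds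
          (show ‖x‖ < (ρ + r) / 2 by linarith)
      filter_upwards [this] with y hy
      simp [g, hχ1 y (le_of_lt hy)]
  refine ⟨g, isSymbol_of_forall hg fun j => ?_, hgf⟩
  obtain ⟨C, hC⟩ := hb j
  have hcont : Continuous fun x => iteratedFDeriv ℝ j g x :=
    hg.continuous_iteratedFDeriv (by exact_mod_cast le_top)
  obtain ⟨B, hB⟩ := (isCompact_closedBall (0 : E n) r).exists_bound_of_continuousOn
    (f := fun x => wt x ^ ((q + j) / 2) * ‖iteratedFDeriv ℝ j g x‖)
    (((contDiff_wt (k := 0)).continuous.rpow_const fun x => Or.inl (wt_pos x).ne').mul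
      hcont.norm).continuousOn
  refine ⟨max B (|C| * (1 + (r ^ 2)⁻¹) ^ |-(-(q + j)) / 2|), fun x => ?_⟩
  by_cases hx : ‖x‖ ≤ r
  · refine le_trans ?_ (mul_le_mul_of_nonneg_right (le_max_left _ _) (wt_rpow_pos x _).le)
    rw [neg_div, rpow_neg (wt_pos x).le, ← div_eq_mul_inv, le_div_iff₀ (wt_rpow_pos x _), mul_comm]
    exact (le_abs_self _).trans (hB x (by simpa using hx))
  · have hx := not_le.1 hx
    refine le_trans ?_ (mul_le_mul_of_nonneg_right (le_max_right _ _) (wt_rpow_pos x _).le)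
    have e : g =ᶠ[𝓝 x] f := by
      filter_upwards [(hopen r).mem_nhds hx] with y hy using hgf y (le_of_lt hy)
    rw [(e.iteratedFDeriv ℝ j).eq_of_nhds, mul_assoc]
    refine (hC x hx).trans ?_
    have h0 : 0 < ‖x‖ := by linarith
    refine (mul_le_mul_of_nonneg_right (le_abs_self C) (rpow_pos_of_pos h0 _).le).trans ?_
    exact mul_le_mul_of_nonneg_left (norm_rpow_le_const_mul_wt_rpow (by linarith) hx.le _)
      (abs_nonneg C)

section RadialIntegral

variable {F : Type*} [NormedAddCommGroup F] [NormedSpace ℝ F]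

/-- The weighted integral of `W` along the ray from `x` to infinity. -/
def radInt {n : ℕ} (s : ℕ) (W : E n → F) (x : E n) : F := ∫ t in Ioi (1 : ℝ), t ^ s • W (t • x)

lemma integrableOn_Ioi_pow_mul_rpow {s : ℕ} {q : ℝ} (hsq : (s : ℝ) + 1 < q) (C a : ℝ) (ha : 0 < a) :
    IntegrableOn (fun t : ℝ => t ^ s * (C * (t * a) ^ (-q))) (Ioi 1) := by
  have h := (integrableOn_Ioi_rpow_of_lt (a := (s : ℝ) - q) (by linarith) one_pos).const_mul
    (C * a ^ (-q))
  refine IntegrableOn.congr_fun h (fun t ht => ?_) measurableSet_Ioi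
  have ht0 : (0 : ℝ) < t := one_pos.trans ht
  rw [mul_rpow ht0.le ha.le, sub_eq_add_neg, rpow_add ht0, rpow_natCast]
  ring

lemma SymBound.norm_smul_le {n : ℕ} {q C : ℝ} {W : E n → F} (hW : SymBound 0 q C W) (hq : 0 ≤ q)
    {t a : ℝ} (ht : 0 < t) {x : E n} (ha : 0 < a) (hx : a ≤ ‖x‖) :
    ‖W (t • x)‖ ≤ C * (t * a) ^ (-q) := by
  refine (hW.norm_le _).trans (mul_le_mul_of_nonneg_left ?_ hW.nonneg)
  have e : ‖t • x‖ = t * ‖x‖ := by rw [norm_smul, norm_eq_abs, abs_of_pos ht]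
  refine (wt_rpow_le_norm_rpow (by rw [e]; nlinarith) (by linarith)).trans ?_
  rw [e]
  exact rpow_le_rpow_of_nonpos (by positivity) (by nlinarith) (by linarith)

lemma SymBound.norm_pow_smul_le {n : ℕ} {q C : ℝ} {W : E n → F} (hW : SymBound 0 q C W)
    (hq : 0 ≤ q) (s : ℕ) {t a : ℝ} (ht : 0 < t) {x : E n} (ha : 0 < a) (hx : a ≤ ‖x‖) :
    ‖t ^ s • W (t • x)‖ ≤ t ^ s * (C * (t * a) ^ (-q)) := by
  rw [norm_smul, norm_pow, norm_eq_abs, abs_of_pos ht]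
  exact mul_le_mul_of_nonneg_left (hW.norm_smul_le hq ht ha hx) (by positivity)

lemma aestronglyMeasurable_ray {n : ℕ} {q : ℝ} {W : E n → F} (hW : IsSymbol q W)
    (s : ℕ) (x : E n) :
    AEStronglyMeasurable (fun t : ℝ => t ^ s • W (t • x)) (volume.restrict (Ioi 1)) := by
  have := hW.1.continuous
  exact Continuous.aestronglyMeasurable (by fun_prop)

lemma integrableOn_ray {n : ℕ} {q : ℝ} {W : E n → F} (hW : IsSymbol q W) {s : ℕ}
    (hs : (s : ℝ) + 1 < q) {x : E n} (hx : x ≠ 0) :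
    IntegrableOn (fun t : ℝ => t ^ s • W (t • x)) (Ioi 1) := by
  obtain ⟨C, hC⟩ := hW.2 0
  have hs0 : (0 : ℝ) ≤ s := Nat.cast_nonneg s
  refine Integrable.mono' (integrableOn_Ioi_pow_mul_rpow hs C ‖x‖ (norm_pos_iff.2 hx))
    (aestronglyMeasurable_ray hW s x) ?_
  filter_upwards [ae_restrict_mem measurableSet_Ioi] with t ht
  exact hC.norm_pow_smul_le (by linarith) s (one_pos.trans ht) (norm_pos_iff.2 hx) le_rfl

lemma exists_norm_radInt_le {n : ℕ} {q : ℝ} {W : E n → F} (hW : IsSymbol q W) {s : ℕ}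
    (hs : (s : ℝ) + 1 < q) : ∃ C : ℝ, ∀ x ≠ 0, ‖radInt s W x‖ ≤ C * ‖x‖ ^ (-q) := by
  obtain ⟨C, hC⟩ := hW.2 0
  have hs0 : (0 : ℝ) ≤ s := Nat.cast_nonneg s
  refine ⟨∫ t in Ioi (1 : ℝ), t ^ s * (C * (t * 1) ^ (-q)), fun x hx => ?_⟩
  have hx0 := norm_pos_iff.2 hx
  rw [← integral_mul_const]
  refine norm_integral_le_of_norm_le
    ((integrableOn_Ioi_pow_mul_rpow hs C 1 one_pos).mul_const _) ?_
  filter_upwards [ae_restrict_mem measurableSet_Ioi] with t ht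
  have ht0 : (0 : ℝ) < t := one_pos.trans ht
  refine (hC.norm_pow_smul_le (by linarith) s ht0 hx0 le_rfl).trans_eq ?_
  rw [mul_rpow ht0.le hx0.le, mul_one]
  ring

lemma hasFDerivAt_radInt {n : ℕ} {q : ℝ} {W : E n → F} (hW : IsSymbol q W) {s : ℕ}
    (hs : (s : ℝ) + 1 < q) {x : E n} (hx : x ≠ 0) :
    HasFDerivAt (radInt s W) (radInt (s + 1) (fderiv ℝ W) x) x := by
  obtain ⟨C, hC⟩ := hW.fderiv.2 0
  have hx0 := norm_pos_iff.2 hx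
  have hs0 : (0 : ℝ) ≤ s := Nat.cast_nonneg s
  refine hasFDerivAt_integral_of_dominated_of_fderiv_le
    (F := fun y t => t ^ s • W (t • y))
    (F' := fun y t => t ^ (s + 1) • fderiv ℝ W (t • y))
    (bound := fun t => t ^ (s + 1) * (C * (t * (‖x‖ / 2)) ^ (-(q + 1))))
    (Metric.ball_mem_nhds x (by positivity : 0 < ‖x‖ / 2))
    (Eventually.of_forall fun y => aestronglyMeasurable_ray hW s y) (integrableOn_ray hW hs hx)
    (aestronglyMeasurable_ray hW.fderiv (s + 1) x) ?_
    (integrableOn_Ioi_pow_mul_rpow (by push_cast; linarith) C _ (by positivity)) ?_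
  · filter_upwards [ae_restrict_mem measurableSet_Ioi] with t ht y hy
    refine hC.norm_pow_smul_le (by linarith) (s + 1) (one_pos.trans ht) (by positivity) ?_
    have h1 : ‖x‖ - ‖y‖ ≤ ‖x - y‖ := norm_sub_norm_le x y
    rw [mem_ball_iff_norm'] at hy
    linarith
  · filter_upwards with t y _
    have h1 : HasFDerivAt (fun y : E n => W (t • y))
        ((fderiv ℝ W (t • y)).comp (t • ContinuousLinearMap.id ℝ (E n))) y :=
      (hW.1.differentiable (by simp) (t • y)).hasFDerivAt.comp y
        ((hasFDerivAt_id y).const_smul t)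
    have h2 : HasFDerivAt (fun y : E n => t ^ s • W (t • y)) _ y := h1.const_smul (t ^ s)
    refine h2.congr_fderiv ?_
    ext v
    simp [pow_succ, mul_smul]

lemma contDiffOn_radInt {F : Type*} [NormedAddCommGroup F] [NormedSpace ℝ F] {n : ℕ}
    (N : ℕ) {q : ℝ} {W : E n → F} (hW : IsSymbol q W) {s : ℕ} (hs : (s : ℝ) + 1 < q) :
    ContDiffOn ℝ N (radInt s W) {0}ᶜ ∧
      ∃ C : ℝ, ∀ x ≠ 0, ‖iteratedFDeriv ℝ N (radInt s W) x‖ ≤ C * ‖x‖ ^ (-(q + N)) := by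
  induction N generalizing F q s with
  | zero =>
    refine ⟨?_, by simpa using exists_norm_radInt_le hW hs⟩
    rw [Nat.cast_zero, contDiffOn_zero]
    exact fun x hx => (hasFDerivAt_radInt hW hs hx).continuousAt.continuousWithinAt
  | succ N ih =>
    obtain ⟨h1, C, hC⟩ := ih hW.fderiv (s := s + 1) (by push_cast; linarith)
    refine ⟨?_, C, fun x hx => ?_⟩
    · push_cast
      rw [contDiffOn_succ_iff_fderiv_of_isOpen isOpen_compl_singleton]
      refine ⟨fun x hx => (hasFDerivAt_radInt hW hs hx).differentiableAt.differentiableWithinAt,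
        by simp, h1.congr fun x hx => (hasFDerivAt_radInt hW hs hx).fderiv⟩
    · rw [← norm_iteratedFDeriv_fderiv]
      have e : fderiv ℝ (radInt s W) =ᶠ[𝓝 x] radInt (s + 1) (fderiv ℝ W) := by
        filter_upwards [isOpen_compl_singleton.mem_nhds hx] with y hy
        exact (hasFDerivAt_radInt hW hs hy).fderiv
      rw [(e.iteratedFDeriv ℝ N).eq_of_nhds]
      refine (hC x hx).trans_eq ?_
      push_cast
      ring_nf

end RadialIntegral

lemma partialD_radInt {n : ℕ} {q : ℝ} {W : E n → ℝ} (hW : IsSymbol q W) {s : ℕ}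
    (hs : (s : ℝ) + 1 < q) {x : E n} (hx : x ≠ 0) (i : Fin n) :
    partialD i (radInt s W) x = radInt (s + 1) (partialD i W) x := by
  rw [(hasFDerivAt_radInt hW hs hx).partialD_eq]
  unfold radInt
  rw [ContinuousLinearMap.integral_apply
    (integrableOn_ray hW.fderiv (s := s + 1) (by push_cast; linarith) hx)]
  rfl

lemma lap_radInt {n : ℕ} {q : ℝ} {W : E n → ℝ} (hW : IsSymbol q W) {s : ℕ}
    (hs : (s : ℝ) + 1 < q) {x : E n} (hx : x ≠ 0) :
    lap n (radInt s W) x = radInt (s + 2) (lap n W) x := by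
  have h2 : ∀ i, partialD i (partialD i (radInt s W)) x =
      radInt (s + 2) (partialD i (partialD i W)) x := fun i => by
    rw [← partialD_radInt (hW.partialD i) (s := s + 1) (by push_cast; linarith) hx i]
    refine partialD_congr ?_
    filter_upwards [isOpen_compl_singleton.mem_nhds hx] with y hy
    exact partialD_radInt hW hs hy i
  rw [lap_eq_sum, Finset.sum_congr rfl fun i _ => h2 i]
  unfold radInt
  rw [← integral_finsetSum _ fun i _ => integrableOn_ray ((hW.partialD i).partialD i) (s := s + 2)
    (by push_cast; linarith) hx]
  refine integral_congr_ae (Eventually.of_forall fun t => ?_)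
  simp only [lap_eq_sum, Finset.smul_sum]

lemma fderiv_apply_eq_sum {n : ℕ} (f : E n → ℝ) (x v : E n) :
    fderiv ℝ f x v = ∑ i, v i * partialD i f x := by
  rw [fderiv_eq_sum_partialD]
  simp

lemma IsSymbol.lap {n : ℕ} {q : ℝ} {f : E n → ℝ} (hf : IsSymbol q f) :
    IsSymbol (q + 2) (lap n f) := by
  have h : IsSymbol (q + 2) fun x => ∑ i, _root_.partialD i (_root_.partialD i f) x :=
    IsSymbol.sum fun i _ => by
      have := (hf.partialD i).partialD i
      rwa [add_assoc, one_add_one_eq_two] at this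
  exact h

lemma radInt_eq_neg {n : ℕ} {q r : ℝ} {G H : E n → ℝ} {s : ℕ} (hs : (s : ℝ) + 1 < q)
    (hG : IsSymbol q G) (hH : IsSymbol q H)
    (h : ∀ y, r < ‖y‖ → H y = (s + 1) * G y + fderiv ℝ G y y) (hr : 0 < r) {x : E n}
    (hx : r < ‖x‖) : radInt s H x = -G x := by
  have hx0 : 0 < ‖x‖ := hr.trans hx
  have hs0 : (0 : ℝ) ≤ s := Nat.cast_nonneg s
  have hd : ∀ t : ℝ, HasDerivAt (fun t : ℝ => t ^ (s + 1) * G (t • x))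
      ((s + 1 : ℕ) * t ^ s * G (t • x) + t ^ (s + 1) * fderiv ℝ G (t • x) x) t := fun t => by
    have h1 : HasDerivAt (fun t : ℝ => t • x) x t := by
      simpa using (hasDerivAt_id t).smul_const x
    have h2 := (hG.1.differentiable (by simp) (t • x)).hasFDerivAt.comp_hasDerivAt t h1
    exact (hasDerivAt_pow (s + 1) t).mul h2
  have key := integral_Ioi_of_hasDerivAt_of_tendsto (a := (1 : ℝ)) (m := 0)
    (f := fun t : ℝ => t ^ (s + 1) * G (t • x)) (f' := fun t => t ^ s • H (t • x))
    (hd 1).continuousAt.continuousWithinAt (fun t ht => ?_)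
    (integrableOn_ray hH hs (norm_pos_iff.1 hx0)) ?_
  · rw [radInt, key]
    simp
  · have ht1 : (1 : ℝ) < t := ht
    refine (hd t).congr_deriv ?_
    rw [h (t • x) (by rw [norm_smul, norm_eq_abs, abs_of_pos (by linarith)]; nlinarith), map_smul]
    push_cast
    simp only [smul_eq_mul]
    ring
  · obtain ⟨C, hC⟩ := hG.2 0
    have h1 := (tendsto_rpow_neg_atTop (y := q - (s + 1)) (by linarith)).const_mul
      (C * ‖x‖ ^ (-q))
    rw [mul_zero] at h1
    refine squeeze_zero_norm' ?_ h1
    filter_upwards [eventually_gt_atTop 0] with t ht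
    refine (hC.norm_pow_smul_le (by linarith) (s + 1) ht hx0 le_rfl).trans_eq ?_
    rw [mul_rpow ht.le hx0.le, neg_sub, sub_eq_add_neg, rpow_add ht, ← rpow_natCast]
    push_cast
    ring

lemma exists_isSymbol_lap_eq_of_sub_one {n : ℕ} (hn : 3 ≤ n) {q r : ℝ} (hqn : n - 2 < q)
    (hr : 0 < r) (h : ∀ G : E n → ℝ, IsSymbol (q - 1 + 2) G →
      ∃ V, IsSymbol (q - 1) V ∧ ∀ x, r < ‖x‖ → lap n V x = G x)
    {G : E n → ℝ} (hG : IsSymbol (q + 2) G) :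
    ∃ V, IsSymbol q V ∧ ∀ x, r < ‖x‖ → lap n V x = G x := by
  obtain ⟨s, rfl⟩ : ∃ s, n = s + 3 := ⟨n - 3, by omega⟩
  have hsq : (s : ℝ) + 1 < q := by push_cast at hqn; linarith
  have hyG : ∀ i : Fin (s + 3), IsSymbol (q - 1 + 2) fun y => y i * G y := fun i => by
    have := (isSymbol_coord i).mul hG
    rwa [show -1 + (q + 2) = q - 1 + 2 by ring] at this
  choose U hU hUlap using fun i => h _ (hyG i)
  set W : E (s + 3) → ℝ := fun x => ∑ i, partialD i (U i) x
  have hW : IsSymbol q W := IsSymbol.sum fun i _ => by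
    have := (hU i).partialD i
    rwa [sub_add_cancel] at this
  have hopen : ∀ c : ℝ, IsOpen {x : E (s + 3) | c < ‖x‖} := fun c =>
    isOpen_lt continuous_const continuous_norm
  have hWlap : ∀ y, r < ‖y‖ → lap (s + 3) W y = ((s + 2 : ℕ) + 1) * G y + fderiv ℝ G y y := by
    intro y hy
    rw [lap_sum _ fun i _ => (contDiff_infty.1 (contDiff_partialD i (hU i).1) 2).contDiffAt]
    have hterm : ∀ i, lap (s + 3) (partialD i (U i)) y = y i * partialD i G y + G y := fun i => by
      have e : lap (s + 3) (U i) =ᶠ[𝓝 y] fun y => y i * G y := by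
        filter_upwards [(hopen r).mem_nhds hy] with z hz using hUlap i z hz
      rw [lap_partialD i (hU i).1, partialD_congr e, partialD_mul
        ((contDiff_coord (k := 1) i).differentiable (by simp) y) (hG.1.differentiable (by simp) y),
        partialD_coord]
      simp
    rw [Finset.sum_congr rfl fun i _ => hterm i, Finset.sum_add_distrib, fderiv_apply_eq_sum]
    simp only [Finset.sum_const, Finset.card_univ, Fintype.card_fin, nsmul_eq_mul]
    push_cast
    ring
  have hlap : ∀ x, r < ‖x‖ → lap (s + 3) (radInt s W) x = -G x := fun x hx => by
    rw [lap_radInt hW hsq (norm_pos_iff.1 (hr.trans hx))]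
    exact radInt_eq_neg (by push_cast; linarith) hG hW.lap hWlap hr hx
  have hsmooth : ∀ N : ℕ, _ := fun N => contDiffOn_radInt N hW hsq
  obtain ⟨V, hV, hVe⟩ := exists_isSymbol_eq_of_lt_norm (ρ := r / 2) (r := r) (q := q)
    (f := radInt s W) (by linarith) (by linarith)
    ((contDiffOn_infty.2 fun N => (hsmooth N).1).mono fun x hx =>
      norm_pos_iff.1 ((half_pos hr).trans hx))
    fun j => (hsmooth j).2.imp fun C hC x hx => hC x (norm_pos_iff.1 (hr.trans hx))
  refine ⟨fun x => (-1) * V x, ?_, fun x hx => ?_⟩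
  · have := (isSymbol_const (n := s + 3) (-1)).mul hV
    rwa [zero_add] at this
  · have e : V =ᶠ[𝓝 x] radInt s W := by
      filter_upwards [(hopen r).mem_nhds hx] with y hy using hVe y (le_of_lt hy)
    rw [lap_const_mul _ (contDiff_infty.1 hV.1 2).contDiffAt, lap_congr e, hlap x hx]
    ring

lemma exists_isSymbol_lap_eq {n : ℕ} (hn : 3 ≤ n) {ε : ℝ} (hε : ε ∈ Ioo (0 : ℝ) 1) {r : ℝ}
    (hr : 0 < r) (p : ℕ) {G : E n → ℝ} (hG : IsSymbol (p + ε + 2) G) :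
    ∃ V, IsSymbol (p + ε) V ∧ ∀ x, r < ‖x‖ → lap n V x = G x := by
  have hp0 : (0 : ℝ) ≤ p := Nat.cast_nonneg p
  induction p generalizing G with
  | zero =>
    have hn' : (3 : ℝ) ≤ n := by exact_mod_cast hn
    obtain ⟨V, hV, hVG⟩ := exists_isSymbol_lap_eq_of_lt hn (q := (0 : ℕ) + ε)
      (by push_cast; linarith [hε.1]) (by push_cast; linarith [hε.2]) hG
    exact ⟨V, hV, fun x _ => hVG x⟩
  | succ p ih =>
    by_cases h : p + 3 < n
    · have h' : (p : ℝ) + 4 ≤ n := by exact_mod_cast h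
      obtain ⟨V, hV, hVG⟩ := exists_isSymbol_lap_eq_of_lt hn
        (by linarith [hε.1]) (by push_cast; linarith [hε.2]) hG
      exact ⟨V, hV, fun x _ => hVG x⟩
    · have h' : (n : ℝ) ≤ p + 3 := by exact_mod_cast not_lt.1 h
      have e : ((p + 1 : ℕ) : ℝ) + ε - 1 = p + ε := by push_cast; ring
      refine exists_isSymbol_lap_eq_of_sub_one hn (by push_cast; linarith [hε.1]) hr ?_ hG
      rw [e]
      exact fun G hG => ih hG (Nat.cast_nonneg p)

/-- The coefficients `(-1)ᵏ 4^{-k(k+1)}`, whose moments against `16ᵏ` all vanish. -/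
def thetaCoeff (k : ℤ) : ℝ := (-1) ^ k * (4 : ℝ) ^ (-(k * (k + 1)))

lemma abs_thetaCoeff (k : ℤ) : |thetaCoeff k| = (4 : ℝ) ^ (-(k * (k + 1))) := by
  rw [thetaCoeff, abs_mul, abs_zpow, abs_neg, abs_one, one_zpow, one_mul,
    abs_of_pos (zpow_pos (by norm_num) _)]

lemma abs_thetaCoeff_mul (k : ℤ) (m : ℕ) :
    |thetaCoeff k| * ((16 : ℝ) ^ k) ^ m = (4 : ℝ) ^ (-(k * (k + 1)) + 2 * k * m) := by
  rw [abs_thetaCoeff, zpow_add₀ (by norm_num), mul_assoc, zpow_mul, zpow_mul _ k (m : ℤ),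
    zpow_natCast]
  norm_num

lemma summable_four_zpow_neg : Summable fun k : ℕ => (4 : ℝ) ^ (-(k : ℤ)) := by
  have h := summable_geometric_of_lt_one (r := (4 : ℝ)⁻¹) (by norm_num) (by norm_num)
  exact h.congr fun k => by rw [zpow_neg, zpow_natCast, inv_pow]

lemma summable_abs_thetaCoeff_mul (m : ℕ) :
    Summable fun k : ℤ => |thetaCoeff k| * ((16 : ℝ) ^ k) ^ m := by
  simp_rw [abs_thetaCoeff_mul]
  refine Summable.of_nat_of_neg_add_one ?_ ?_
  · refine Summable.of_nonneg_of_le (fun k => by positivity) (fun k => ?_)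
      (summable_four_zpow_neg.mul_left ((4 : ℝ) ^ ((m : ℤ) ^ 2)))
    rw [← zpow_add₀ (by norm_num)]
    exact zpow_le_zpow_right₀ (by norm_num) (by nlinarith [sq_nonneg ((k : ℤ) - m)])
  · refine Summable.of_nonneg_of_le (fun k => by positivity) (fun k => ?_)
      summable_four_zpow_neg
    refine zpow_le_zpow_right₀ (by norm_num) ?_
    have h1 : (0 : ℤ) ≤ k := Int.natCast_nonneg k
    have h2 : (0 : ℤ) ≤ m := Int.natCast_nonneg m
    nlinarith [mul_nonneg h1 h2]

lemma tsum_thetaCoeff_mul (m : ℕ) : ∑' k : ℤ, thetaCoeff k * ((16 : ℝ) ^ k) ^ m = 0 := by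
  induction m with
  | zero =>
    simp only [pow_zero, mul_one]
    have h : ∀ k : ℤ, thetaCoeff (-1 - k) = -thetaCoeff k := fun k => by
      unfold thetaCoeff
      rw [show -((-1 - k) * (-1 - k + 1)) = -(k * (k + 1)) by ring,
        zpow_sub₀ (by norm_num : (-1 : ℝ) ≠ 0), zpow_neg_one]
      rcases Int.even_or_odd k with hk | hk
      · simp [hk.neg_one_zpow]
      · simp [hk.neg_one_zpow]
    have h1 := (Equiv.subLeft (-1 : ℤ)).tsum_eq thetaCoeff
    simp only [Equiv.subLeft_apply, h, tsum_neg] at h1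
    linarith
  | succ m ih =>
    rw [← (Equiv.addRight (1 : ℤ)).tsum_eq]
    have h : ∀ k : ℤ, thetaCoeff (k + 1) * ((16 : ℝ) ^ (k + 1)) ^ (m + 1) =
        -(16 ^ m) * (thetaCoeff k * ((16 : ℝ) ^ k) ^ m) := fun k => by
      unfold thetaCoeff
      rw [show -((k + 1) * (k + 1 + 1)) = -(k * (k + 1)) + (-k + -k) + -2 by ring,
        zpow_add₀ (by norm_num : (-1 : ℝ) ≠ 0), zpow_add₀ (by norm_num : (16 : ℝ) ≠ 0),
        zpow_add₀ (by norm_num : (4 : ℝ) ≠ 0), zpow_add₀ (by norm_num : (4 : ℝ) ≠ 0),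
        zpow_add₀ (by norm_num : (4 : ℝ) ≠ 0)]
      have h16 : (16 : ℝ) ^ k = 4 ^ k * 4 ^ k := by rw [← mul_zpow]; norm_num
      have h4 : (4 : ℝ) ^ k ≠ 0 := (zpow_pos (by norm_num) _).ne'
      rw [zpow_neg _ k, h16]
      norm_num
      field_simp
      rw [pow_succ, mul_pow]
      ring
    simp only [Equiv.coe_addRight, h]
    rw [tsum_mul_left, ih, mul_zero]

lemma tsum_le_of_abs_le_geometric {g : ℕ → ℝ} (hg : ∀ n, |g (n + 1)| ≤ (1 / 16) ^ (n + 1)) :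
    ∑' n, g n ≤ g 0 + 1 / 15 := by
  have hgeo := summable_geometric_of_lt_one (r := (1 / 16 : ℝ)) (by norm_num) (by norm_num)
  have hs1 : Summable fun n : ℕ => (1 / 16 : ℝ) ^ (n + 1) := (summable_nat_add_iff 1).2 hgeo
  have hs : Summable fun n => g (n + 1) := .of_norm_bounded hs1 hg
  rw [((summable_nat_add_iff 1).1 hs).tsum_eq_zero_add]
  have h1 : ∑' n : ℕ, (1 / 16 : ℝ) ^ (n + 1) = 1 / 15 := by
    simp_rw [pow_succ, tsum_mul_right]
    rw [tsum_geometric_of_lt_one (by norm_num) (by norm_num)]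
    norm_num
  have := hs.tsum_le_tsum (fun n => (le_abs_self _).trans (hg n)) hs1
  linarith

lemma abs_thetaCoeff_div_le (k : ℤ) : |thetaCoeff k / (1 + 16 ^ k)| ≤ |thetaCoeff k| := by
  have : (0 : ℝ) < 16 ^ k := zpow_pos (by norm_num) _
  rw [abs_div, abs_of_pos (a := 1 + (16 : ℝ) ^ k) (by linarith)]
  exact div_le_self (abs_nonneg _) (by linarith)

lemma summable_thetaCoeff_div : Summable fun k : ℤ => thetaCoeff k / (1 + 16 ^ k) :=
  .of_norm_bounded (by simpa using summable_abs_thetaCoeff_mul 0) abs_thetaCoeff_div_le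

lemma tsum_thetaCoeff_div_neg : ∑' k : ℤ, thetaCoeff k / (1 + 16 ^ k) < 0 := by
  have hs := summable_thetaCoeff_div
  rw [tsum_of_nat_of_neg_add_one (f := fun k : ℤ => thetaCoeff k / (1 + 16 ^ k))
    (hs.comp_injective Nat.cast_injective)
    (hs.comp_injective (i := fun n : ℕ => -((n : ℤ) + 1)) fun a b h => by simpa using h)]
  have hle : ∀ n : ℕ, ∀ k : ℤ, 2 * (n + 1 : ℤ) ≤ k * (k + 1) →
      |thetaCoeff k / (1 + 16 ^ k)| ≤ (1 / 16) ^ (n + 1) := fun n k hk => by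
    refine (abs_thetaCoeff_div_le k).trans ?_
    rw [abs_thetaCoeff]
    refine (zpow_le_zpow_right₀ (by norm_num) (neg_le_neg hk)).trans_eq ?_
    rw [zpow_neg, zpow_mul, ← inv_zpow]
    norm_num
    norm_cast
  have h1 := tsum_le_of_abs_le_geometric (g := fun n : ℕ => thetaCoeff n / (1 + 16 ^ (n : ℤ)))
    fun n => hle n _ (by push_cast; nlinarith [Int.natCast_nonneg n])
  have h2 := tsum_le_of_abs_le_geometric
    (g := fun n : ℕ => thetaCoeff (-((n : ℤ) + 1)) / (1 + 16 ^ (-((n : ℤ) + 1))))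
    fun n => hle n _ (by push_cast; nlinarith [Int.natCast_nonneg n])
  have e1 : thetaCoeff (0 : ℕ) / (1 + 16 ^ ((0 : ℕ) : ℤ)) = 1 / 2 := by norm_num [thetaCoeff]
  have e2 : thetaCoeff (-(((0 : ℕ) : ℤ) + 1)) / (1 + 16 ^ (-(((0 : ℕ) : ℤ) + 1))) = -(16 / 17) := by
    norm_num [thetaCoeff]
  simp only [e1, e2] at h1 h2
  linarith

/-- Coefficients for Seeley's extension: `∑ aₖ bₖᵐ = (-1)ᵐ` for all `m`, absolutely. -/
lemma exists_seeley_coeff : ∃ a b : ℤ → ℝ, (∀ k, 0 < b k) ∧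
    (∀ m : ℕ, Summable fun k => |a k| * b k ^ m) ∧ ∀ m : ℕ, ∑' k, a k * b k ^ m = (-1) ^ m := by
  set M := ∑' k : ℤ, thetaCoeff k / (1 + 16 ^ k) with hM
  have hM0 : M ≠ 0 := tsum_thetaCoeff_div_neg.ne
  have hb : ∀ k : ℤ, (0 : ℝ) < 16 ^ k := fun k => zpow_pos (by norm_num) _
  have hsum : ∀ m : ℕ, Summable fun k : ℤ =>
      |thetaCoeff k / (1 + 16 ^ k) / M| * ((16 : ℝ) ^ k) ^ m := fun m => by
    refine Summable.of_nonneg_of_le (fun k => mul_nonneg (abs_nonneg _) (pow_pos (hb k) m).le)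
      (fun k => ?_) ((summable_abs_thetaCoeff_mul m).mul_left |M|⁻¹)
    rw [abs_div, div_eq_inv_mul, mul_assoc]
    exact mul_le_mul_of_nonneg_left (mul_le_mul_of_nonneg_right (abs_thetaCoeff_div_le k)
      (pow_pos (hb k) m).le) (inv_nonneg.2 (abs_nonneg M))
  have hsum' : ∀ m : ℕ, Summable fun k : ℤ =>
      thetaCoeff k / (1 + 16 ^ k) / M * ((16 : ℝ) ^ k) ^ m := fun m =>
    .of_norm_bounded (hsum m) fun k => by
      rw [norm_mul, norm_eq_abs, norm_eq_abs, abs_of_pos (pow_pos (hb k) m)]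
  refine ⟨fun k => thetaCoeff k / (1 + 16 ^ k) / M, fun k => 16 ^ k, hb, hsum, fun m => ?_⟩
  induction m with
  | zero =>
    simp only [pow_zero, mul_one]
    rw [tsum_div_const, ← hM, div_self hM0]
  | succ m ih =>
    have h : ∑' k : ℤ, (thetaCoeff k / (1 + 16 ^ k) / M * ((16 : ℝ) ^ k) ^ (m + 1) +
        thetaCoeff k / (1 + 16 ^ k) / M * ((16 : ℝ) ^ k) ^ m) = 0 := by
      have e : ∀ k : ℤ, thetaCoeff k / (1 + 16 ^ k) / M * ((16 : ℝ) ^ k) ^ (m + 1) +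
          thetaCoeff k / (1 + 16 ^ k) / M * ((16 : ℝ) ^ k) ^ m =
          M⁻¹ * (thetaCoeff k * ((16 : ℝ) ^ k) ^ m) := fun k => by
        have : (1 : ℝ) + 16 ^ k ≠ 0 := by linarith [hb k]
        field_simp
        ring
      simp_rw [e]
      rw [tsum_mul_left, tsum_thetaCoeff_mul, mul_zero]
    rw [(hsum' (m + 1)).tsum_add (hsum' m), ih] at h
    rw [pow_succ]
    linarith

section SeeleyExtension

variable {H : Type*} [NormedAddCommGroup H] [NormedSpace ℝ H]

/-- A radial vector field vanishing on the sphere of radius `R`. -/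
def reflVec {n : ℕ} (R : ℝ) (x : E n) : E n := (1 - ‖x‖ ^ 2 / R ^ 2) • x

/-- A reflection across the sphere of radius `R`, stretched by the factor `b`. -/
def reflMap {n : ℕ} (R b : ℝ) (x : E n) : E n := x + (1 + b) • reflVec R x

lemma contDiff_reflVec {n : ℕ} (R : ℝ) : ContDiff ℝ ∞ (reflVec R : E n → E n) :=
  (contDiff_const.sub ((contDiff_norm_sq ℝ).div_const _)).smul contDiff_id

lemma hasFDerivAt_reflMap {n : ℕ} (R b : ℝ) (x : E n) : HasFDerivAt (reflMap R b)
    (ContinuousLinearMap.id ℝ (E n) + (1 + b) • fderiv ℝ (reflVec R) x) x :=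
  (hasFDerivAt_id x).add
    (((contDiff_reflVec R).differentiable (by simp) x).hasFDerivAt.const_smul (1 + b))

lemma reflMap_of_norm_eq {n : ℕ} {R : ℝ} (hR : 0 < R) (b : ℝ) {x : E n} (hx : ‖x‖ = R) :
    reflMap R b x = x := by
  simp [reflMap, reflVec, hx, hR.ne']

lemma lt_norm_reflMap {n : ℕ} {R b : ℝ} (hR : 0 < R) (hb : 0 < b) {x : E n}
    (h1 : 3 / 4 * R < ‖x‖) (h2 : ‖x‖ < R) : R < ‖reflMap R b x‖ := by
  set u := ‖x‖ / R with hu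
  have hxu : ‖x‖ = u * R := by rw [hu]; field_simp
  have hu1 : 3 / 4 < u := by rw [hu, lt_div_iff₀ hR]; exact h1
  have hu2 : u < 1 := by rw [hu, div_lt_one hR]; exact h2
  have e : reflMap R b x = (1 + (1 + b) * (1 - u ^ 2)) • x := by
    rw [reflMap, reflVec, hu, div_pow, smul_smul, add_smul, one_smul]
  have h3 : 0 < 1 - u ^ 2 := by nlinarith
  have h4 : 0 < b * (1 - u ^ 2) := mul_pos hb h3
  rw [e, norm_smul, norm_eq_abs, abs_of_pos (by nlinarith), hxu]
  have h5 : 1 < (1 + (1 - u ^ 2)) * u := by nlinarith [mul_pos (sub_pos.2 hu2) (sub_pos.2 hu1)]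
  have h6 : 1 < (1 + (1 + b) * (1 - u ^ 2)) * u := by nlinarith
  nlinarith

lemma le_norm_reflMap {n : ℕ} {R b : ℝ} (hR : 0 < R) (hb : 0 < b) {x : E n}
    (h1 : 3 / 4 * R < ‖x‖) (h2 : ‖x‖ ≤ R) : R ≤ ‖reflMap R b x‖ := by
  rcases h2.lt_or_eq with h | h
  · exact (lt_norm_reflMap hR hb h1 h).le
  · rw [reflMap_of_norm_eq hR b h, h]

lemma isOpen_lt_norm {n : ℕ} (c : ℝ) : IsOpen {x : E n | c < ‖x‖} :=
  isOpen_lt continuous_const continuous_norm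

lemma Sset_mem_nhds {n : ℕ} {R : ℝ} {x : E n} (hx : R < ‖x‖) : Sset n R ∈ 𝓝 x :=
  mem_of_superset ((isOpen_lt_norm R).mem_nhds hx) fun y hy => show R ≤ ‖y‖ from le_of_lt hy

lemma uniqueDiffOn_Sset {n : ℕ} {R : ℝ} (hR : 0 < R) : UniqueDiffOn ℝ (Sset n R) := by
  intro x hx
  have hx0 : 0 < ‖x‖ := hR.trans_le hx
  set K : Set (E n) := {y | ‖x‖ ^ 2 ≤ inner ℝ x y}
  have hKS : K ⊆ Sset n R := fun y hy => by
    have h1 : ‖x‖ ^ 2 ≤ ‖x‖ * ‖y‖ := le_trans hy (real_inner_le_norm x y)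
    have h2 : ‖x‖ ≤ ‖y‖ := by nlinarith
    exact le_trans hx h2
  have hconv : Convex ℝ K :=
    convex_halfSpace_ge (innerSL ℝ x).toLinearMap.isLinear _
  have hInt : (interior K).Nonempty := by
    refine ⟨(2 : ℝ) • x, mem_interior.2 ⟨{y | ‖x‖ ^ 2 < inner ℝ x y}, fun y hy =>
      show ‖x‖ ^ 2 ≤ inner ℝ x y from le_of_lt hy, isOpen_lt continuous_const (by fun_prop),
      ?_⟩⟩
    show ‖x‖ ^ 2 < inner ℝ x ((2 : ℝ) • x)
    rw [inner_smul_right, real_inner_self_eq_norm_sq]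
    nlinarith [pow_pos hx0 2]
  exact (uniqueDiffWithinAt_convex hconv hInt (subset_closure
    (show ‖x‖ ^ 2 ≤ inner ℝ x x by rw [real_inner_self_eq_norm_sq]))).mono hKS

/-- Smoothness up to the boundary with bounded derivatives of all orders. -/
def IsBddSmoothOn {n : ℕ} (S : Set (E n)) (f : E n → H) : Prop :=
  ContDiffOn ℝ ∞ f S ∧ ∀ j : ℕ, ∃ C : ℝ, ∀ x ∈ S, ‖iteratedFDerivWithin ℝ j f S x‖ ≤ C

lemma IsBddSmoothOn.exists_norm_le {n : ℕ} {S : Set (E n)} {f : E n → H}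
    (hf : IsBddSmoothOn S f) : ∃ C : ℝ, ∀ x ∈ S, ‖f x‖ ≤ C := by
  simpa using hf.2 0

lemma IsBddSmoothOn.fderivWithin {n : ℕ} {S : Set (E n)} {f : E n → H}
    (hf : IsBddSmoothOn S f) (hS : UniqueDiffOn ℝ S) :
    IsBddSmoothOn S (fderivWithin ℝ f S) :=
  ⟨hf.1.fderivWithin hS (by simp), fun j => (hf.2 (j + 1)).imp fun C hC x hx => by
    rw [norm_iteratedFDerivWithin_fderivWithin hS hx]
    exact hC x hx⟩

/-- Coefficients and dilations for Seeley's extension. -/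
def IsSeeley (a b : ℤ → ℝ) : Prop := (∀ k, 0 < b k) ∧
    (∀ m : ℕ, Summable fun k => |a k| * b k ^ m) ∧ ∀ m : ℕ, ∑' k, a k * b k ^ m = (-1) ^ m

/-- The weighted superposition of the reflections of `f`. -/
def seeleySum {n : ℕ} (a b : ℤ → ℝ) (R : ℝ) (m : ℕ) (f : E n → H) (x : E n) : H :=
  ∑' k, (a k * b k ^ m) • f (reflMap R (b k) x)

open Classical in
/-- Seeley's extension of `f` across the sphere of radius `R`. -/
def seeleyExt {n : ℕ} (a b : ℤ → ℝ) (R : ℝ) (m : ℕ) (f : E n → H) (x : E n) : H :=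
  if R ≤ ‖x‖ then f x else (-1 : ℝ) ^ m • seeleySum a b R m f x

lemma seeleyExt_of_le {n : ℕ} {a b : ℤ → ℝ} {R : ℝ} {m : ℕ} {f : E n → H} {x : E n}
    (hx : R ≤ ‖x‖) : seeleyExt a b R m f x = f x := if_pos hx

lemma seeleyExt_of_norm_le [CompleteSpace H] {n : ℕ} {a b : ℤ → ℝ} (hab : IsSeeley a b) {R : ℝ}
    (hR : 0 < R) {m : ℕ} {f : E n → H} {x : E n} (hx : ‖x‖ ≤ R) :
    seeleyExt a b R m f x = (-1 : ℝ) ^ m • seeleySum a b R m f x := by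
  rcases hx.lt_or_eq with h | h
  · exact if_neg (not_le.2 h)
  · rw [seeleyExt_of_le h.ge, seeleySum]
    have hs : Summable fun k => a k * b k ^ m := .of_norm_bounded (hab.2.1 m) fun k => by
      rw [norm_mul, norm_eq_abs, norm_eq_abs, abs_of_pos (pow_pos (hab.1 k) m)]
    simp_rw [reflMap_of_norm_eq hR _ h]
    rw [hs.tsum_smul_const, hab.2.2, smul_smul, ← mul_pow]
    simp

lemma IsSeeley.norm_smul_le {n : ℕ} {a b : ℤ → ℝ} (hab : IsSeeley a b) {R C : ℝ} (hR : 0 < R)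
    {f : E n → H} (hf : ∀ x ∈ Sset n R, ‖f x‖ ≤ C) (m : ℕ) (k : ℤ) {x : E n}
    (h1 : 3 / 4 * R < ‖x‖) (h2 : ‖x‖ ≤ R) :
    ‖(a k * b k ^ m) • f (reflMap R (b k) x)‖ ≤ |a k| * b k ^ m * C := by
  rw [norm_smul, norm_mul, norm_eq_abs, norm_eq_abs, abs_of_pos (pow_pos (hab.1 k) m)]
  exact mul_le_mul_of_nonneg_left (hf _ (le_norm_reflMap hR (hab.1 k) h1 h2))
    (mul_nonneg (abs_nonneg _) (pow_pos (hab.1 k) m).le)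

lemma IsSeeley.hasSum_seeleySum [CompleteSpace H] {n : ℕ} {a b : ℤ → ℝ} (hab : IsSeeley a b)
    {R : ℝ} (hR : 0 < R) {f : E n → H} (hf : IsBddSmoothOn (Sset n R) f) (m : ℕ) {x : E n}
    (h1 : 3 / 4 * R < ‖x‖) (h2 : ‖x‖ ≤ R) :
    HasSum (fun k => (a k * b k ^ m) • f (reflMap R (b k) x)) (seeleySum a b R m f x) := by
  obtain ⟨C, hC⟩ := hf.exists_norm_le
  exact (Summable.of_norm_bounded ((hab.2.1 m).mul_right C)
    fun k => hab.norm_smul_le hR hC m k h1 h2).hasSum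

lemma IsSeeley.continuousOn_seeleyExt [CompleteSpace H] {n : ℕ} {a b : ℤ → ℝ}
    (hab : IsSeeley a b) {R : ℝ} (hR : 0 < R) {f : E n → H} (hf : IsBddSmoothOn (Sset n R) f)
    (m : ℕ) : ContinuousOn (seeleyExt a b R m f) {x | 3 / 4 * R < ‖x‖} := by
  obtain ⟨C, hC⟩ := hf.exists_norm_le
  have hsum : ContinuousOn (seeleySum a b R m f) {x | 3 / 4 * R < ‖x‖ ∧ ‖x‖ ≤ R} := by
    refine continuousOn_tsum (fun k => ContinuousOn.const_smul ?_ _)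
      ((hab.2.1 m).mul_right C) fun k x hx => hab.norm_smul_le hR hC m k hx.1 hx.2
    exact hf.1.continuousOn.comp (fun x _ =>
      (hasFDerivAt_reflMap R (b k) x).continuousAt.continuousWithinAt)
      fun x hx => le_norm_reflMap hR (hab.1 k) hx.1 hx.2
  have h1 : ContinuousOn (seeleyExt a b R m f) {x | 3 / 4 * R < ‖x‖ ∧ ‖x‖ ≤ R} :=
    (hsum.const_smul ((-1 : ℝ) ^ m)).congr fun x hx => seeleyExt_of_norm_le hab hR hx.2
  have h2 : ContinuousOn (seeleyExt a b R m f) (Sset n R) :=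
    hf.1.continuousOn.congr fun x hx => seeleyExt_of_le hx
  intro x hx
  rcases lt_trichotomy ‖x‖ R with h | h | h
  · refine ((h1 x ⟨hx, h.le⟩).continuousAt ?_).continuousWithinAt
    filter_upwards [(isOpen_lt_norm (3 / 4 * R)).mem_nhds hx,
      (isOpen_lt continuous_norm continuous_const).mem_nhds h] with y hy hy'
    exact ⟨hy, le_of_lt hy'⟩
  · refine ((h1 x ⟨hx, h.le⟩).union (h2 x h.ge)).mono fun y hy => ?_
    exact (le_total ‖y‖ R).imp (fun h => ⟨hy, h⟩) id
  · exact ((h2 x h.le).continuousAt (Sset_mem_nhds h)).continuousWithinAt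

end SeeleyExtension

section SeeleySmoothness

variable {H : Type*} [NormedAddCommGroup H] [NormedSpace ℝ H]

/-- The derivative of Seeley's extension, expressed through extensions of the derivative. -/
def seeleyDeriv {n : ℕ} (a b : ℤ → ℝ) (R : ℝ) (m : ℕ) (f : E n → H) (x : E n) : E n →L[ℝ] H :=
  (seeleyExt a b R m (fderivWithin ℝ f (Sset n R)) x).comp
      (ContinuousLinearMap.id ℝ (E n) + fderiv ℝ (reflVec R) x) -
    (seeleyExt a b R (m + 1) (fderivWithin ℝ f (Sset n R)) x).comp (fderiv ℝ (reflVec R) x)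

lemma seeleyDeriv_of_le {n : ℕ} {a b : ℤ → ℝ} {R : ℝ} {m : ℕ} {f : E n → H} {x : E n}
    (hx : R ≤ ‖x‖) : seeleyDeriv a b R m f x = fderivWithin ℝ f (Sset n R) x := by
  rw [seeleyDeriv, seeleyExt_of_le hx, seeleyExt_of_le hx, ContinuousLinearMap.comp_add,
    ContinuousLinearMap.comp_id, add_sub_cancel_right]

lemma contDiff_fderiv_reflVec {n : ℕ} (R : ℝ) :
    ContDiff ℝ ∞ (fderiv ℝ (reflVec R : E n → E n)) :=
  (contDiff_reflVec R).fderiv_right (by simp)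

lemma IsSeeley.continuousOn_seeleyDeriv [CompleteSpace H] {n : ℕ} {a b : ℤ → ℝ}
    (hab : IsSeeley a b) {R : ℝ} (hR : 0 < R) {f : E n → H} (hf : IsBddSmoothOn (Sset n R) f)
    (m : ℕ) : ContinuousOn (seeleyDeriv a b R m f) {x | 3 / 4 * R < ‖x‖} := by
  have hf' := hf.fderivWithin (uniqueDiffOn_Sset hR)
  have hB := (contDiff_fderiv_reflVec (n := n) R).continuous.continuousOn
    (s := {x | 3 / 4 * R < ‖x‖})
  exact ((hab.continuousOn_seeleyExt hR hf' m).clm_comp (continuousOn_const.add hB)).sub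
    ((hab.continuousOn_seeleyExt hR hf' (m + 1)).clm_comp hB)

lemma IsSeeley.hasFDerivAt_seeleySum [CompleteSpace H] {n : ℕ} {a b : ℤ → ℝ}
    (hab : IsSeeley a b) {R : ℝ} (hR : 0 < R) {f : E n → H} (hf : IsBddSmoothOn (Sset n R) f)
    (m : ℕ) {x : E n} (h1 : 3 / 4 * R < ‖x‖) (h2 : ‖x‖ < R) :
    HasFDerivAt (seeleySum a b R m f)
      ((seeleySum a b R m (_root_.fderivWithin ℝ f (Sset n R)) x).comp
        (ContinuousLinearMap.id ℝ (E n) + fderiv ℝ (reflVec R) x) +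
      (seeleySum a b R (m + 1) (_root_.fderivWithin ℝ f (Sset n R)) x).comp
        (fderiv ℝ (reflVec R) x)) x := by
  have hf' := hf.fderivWithin (uniqueDiffOn_Sset hR)
  obtain ⟨C, hC⟩ := hf'.exists_norm_le
  set f' := fderivWithin ℝ f (Sset n R) with hf'def
  set B : E n → E n →L[ℝ] E n := fderiv ℝ (reflVec R) with hBdef
  have hB : Continuous B := (contDiff_fderiv_reflVec (n := n) R).continuous
  set M := ‖B x‖ + 1
  have hU : {y : E n | 3 / 4 * R < ‖y‖} ∩ {y | ‖y‖ < R} ∩ {y | ‖B y‖ < M} ∈ 𝓝 x :=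
    (((isOpen_lt_norm _).inter (isOpen_lt continuous_norm continuous_const)).inter
      (isOpen_lt hB.norm continuous_const)).mem_nhds ⟨⟨h1, h2⟩,
      show ‖B x‖ < ‖B x‖ + 1 from lt_add_one _⟩
  obtain ⟨δ, hδ, hball⟩ := Metric.mem_nhds_iff.1 hU
  have hC0 : 0 ≤ C := by
    have := hC _ (le_norm_reflMap hR (hab.1 0) h1 h2.le)
    exact (norm_nonneg _).trans this
  have hM0 : 0 ≤ M := by positivity
  have key := hasFDerivAt_tsum_of_isPreconnected (𝕜 := ℝ)
    (f := fun (k : ℤ) y => (a k * b k ^ m) • f (reflMap R (b k) y))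
    (f' := fun k y => (a k * b k ^ m) • (f' (reflMap R (b k) y)).comp
      (ContinuousLinearMap.id ℝ (E n) + (1 + b k) • B y))
    (u := fun k => |a k| * b k ^ m * (C * (1 + M)) + |a k| * b k ^ (m + 1) * (C * M))
    (x₀ := x) (x := x)
    (((hab.2.1 m).mul_right _).add ((hab.2.1 (m + 1)).mul_right _))
    Metric.isOpen_ball (convex_ball x δ).isPreconnected ?_ ?_ (Metric.mem_ball_self hδ)
    (hab.hasSum_seeleySum hR hf m h1 h2.le).summable (Metric.mem_ball_self hδ)
  · refine key.congr_fderiv (HasSum.tsum_eq ?_)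
    have e1 := (hab.hasSum_seeleySum hR hf' m h1 h2.le).mapL
      ((ContinuousLinearMap.compL ℝ (E n) (E n) H).flip
        (ContinuousLinearMap.id ℝ (E n) + B x))
    have e2 := (hab.hasSum_seeleySum hR hf' (m + 1) h1 h2.le).mapL
      ((ContinuousLinearMap.compL ℝ (E n) (E n) H).flip (B x))
    refine (e1.add e2).congr_fun ?_
    intro k
    ext v
    simp [pow_succ, add_smul, mul_smul, smul_add, add_assoc]
  · intro k y hy
    obtain ⟨⟨hy1, hy2⟩, -⟩ := hball hy
    have hd : HasFDerivAt f (f' (reflMap R (b k) y)) (reflMap R (b k) y) := by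
      have h := lt_norm_reflMap hR (hab.1 k) hy1 hy2
      exact ((hf.1.differentiableOn (by simp) _ h.le).hasFDerivWithinAt).hasFDerivAt
        (Sset_mem_nhds h)
    exact (hd.comp y (hasFDerivAt_reflMap R (b k) y)).const_smul _
  · intro k y hy
    obtain ⟨⟨hy1, hy2⟩, hy3⟩ := hball hy
    have hbk := hab.1 k
    have n1 : ‖ContinuousLinearMap.id ℝ (E n) + (1 + b k) • B y‖ ≤ 1 + (1 + b k) * M := by
      refine (norm_add_le _ _).trans (add_le_add ContinuousLinearMap.norm_id_le ?_)
      rw [norm_smul, norm_eq_abs, abs_of_pos (by positivity)]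
      exact mul_le_mul_of_nonneg_left (le_of_lt hy3) (by positivity)
    have n2 := hC _ (le_norm_reflMap hR hbk hy1 (le_of_lt hy2))
    show ‖(a k * b k ^ m) • (f' (reflMap R (b k) y)).comp
      (ContinuousLinearMap.id ℝ (E n) + (1 + b k) • B y)‖ ≤ _
    rw [norm_smul, norm_mul, norm_eq_abs, norm_eq_abs, abs_of_pos (pow_pos hbk m)]
    calc |a k| * b k ^ m * ‖(f' (reflMap R (b k) y)).comp
          (ContinuousLinearMap.id ℝ (E n) + (1 + b k) • B y)‖
        ≤ |a k| * b k ^ m * (C * (1 + (1 + b k) * M)) := by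
          refine mul_le_mul_of_nonneg_left
            ((ContinuousLinearMap.opNorm_comp_le _ _).trans ?_) (by positivity)
          exact mul_le_mul n2 n1 (norm_nonneg _) hC0
      _ = _ := by ring

lemma IsSeeley.hasFDerivAt_seeleyExt_of_lt [CompleteSpace H] {n : ℕ} {a b : ℤ → ℝ}
    (hab : IsSeeley a b) {R : ℝ} (hR : 0 < R) {f : E n → H} (hf : IsBddSmoothOn (Sset n R) f)
    (m : ℕ) {x : E n} (h1 : 3 / 4 * R < ‖x‖) (h2 : ‖x‖ < R) :
    HasFDerivAt (seeleyExt a b R m f) (seeleyDeriv a b R m f x) x := by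
  have h := (hab.hasFDerivAt_seeleySum hR hf m h1 h2).const_smul ((-1 : ℝ) ^ m)
  refine (h.congr_of_eventuallyEq ?_).congr_fderiv ?_
  · filter_upwards [(isOpen_lt continuous_norm continuous_const).mem_nhds h2] with y hy
    exact seeleyExt_of_norm_le hab hR (le_of_lt hy)
  · rw [seeleyDeriv, seeleyExt_of_norm_le hab hR h2.le, seeleyExt_of_norm_le hab hR h2.le]
    ext v
    simp [pow_succ]

lemma IsSeeley.hasFDerivAt_seeleyExt [CompleteSpace H] {n : ℕ} {a b : ℤ → ℝ}
    (hab : IsSeeley a b) {R : ℝ} (hR : 0 < R) {f : E n → H} (hf : IsBddSmoothOn (Sset n R) f)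
    (m : ℕ) {x : E n} (h1 : 3 / 4 * R < ‖x‖) :
    HasFDerivAt (seeleyExt a b R m f) (seeleyDeriv a b R m f x) x := by
  rcases lt_or_ge ‖x‖ R with h2 | h2
  · exact hab.hasFDerivAt_seeleyExt_of_lt hR hf m h1 h2
  have hout : HasFDerivWithinAt (seeleyExt a b R m f) (seeleyDeriv a b R m f x) (Sset n R) x := by
    rw [seeleyDeriv_of_le h2]
    exact (hf.1.differentiableOn (by simp) x h2).hasFDerivWithinAt.congr
      (fun y hy => seeleyExt_of_le hy) (seeleyExt_of_le h2)
  rcases h2.lt_or_eq with h2 | h2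
  · exact hout.hasFDerivAt (Sset_mem_nhds h2)
  set s := Metric.ball (0 : E n) R ∩ Metric.ball x (R / 8)
  have hΩ : Metric.closedBall x (R / 8) ⊆ {y | 3 / 4 * R < ‖y‖} := fun y hy => by
    rw [mem_closedBall_iff_norm'] at hy
    have := norm_sub_norm_le x y
    show 3 / 4 * R < ‖y‖
    linarith
  have hsc : closure s ⊆ Metric.closedBall x (R / 8) :=
    (closure_mono inter_subset_right).trans Metric.closure_ball_subset_closedBall
  have hs : ∀ y ∈ s, HasFDerivAt (seeleyExt a b R m f) (seeleyDeriv a b R m f y) y :=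
    fun y hy => hab.hasFDerivAt_seeleyExt_of_lt hR hf m
      (hΩ (Metric.ball_subset_closedBall hy.2)) (mem_ball_zero_iff.1 hy.1)
  have hΩo := isOpen_lt_norm (n := n) (3 / 4 * R)
  have hin : HasFDerivWithinAt (seeleyExt a b R m f) (seeleyDeriv a b R m f x) (closure s) x := by
    refine hasFDerivWithinAt_closure_of_tendsto_fderiv
      (fun y hy => (hs y hy).differentiableAt.differentiableWithinAt)
      ((convex_ball _ _).inter (convex_ball _ _)) (Metric.isOpen_ball.inter Metric.isOpen_ball)
      (fun y hy => ((hab.continuousOn_seeleyExt hR hf m).continuousAt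
        (hΩo.mem_nhds (hΩ (hsc hy)))).continuousWithinAt) ?_
    refine Tendsto.congr' ?_ (((hab.continuousOn_seeleyDeriv hR hf m).continuousAt
        (hΩo.mem_nhds h1)).continuousWithinAt (s := s))
    filter_upwards [self_mem_nhdsWithin] with y hy
    exact (hs y hy).fderiv.symm
  refine (hout.union hin).hasFDerivAt ?_
  filter_upwards [Metric.ball_mem_nhds x (by positivity : 0 < R / 8)] with y hy
  rcases lt_or_ge ‖y‖ R with h | h
  · exact Or.inr (subset_closure ⟨mem_ball_zero_iff.2 h, hy⟩)
  · exact Or.inl h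

lemma IsSeeley.contDiffOn_seeleyExt_nat {H : Type*} [NormedAddCommGroup H] [NormedSpace ℝ H]
    [CompleteSpace H] {n : ℕ} {a b : ℤ → ℝ} (hab : IsSeeley a b) {R : ℝ} (hR : 0 < R) (N : ℕ)
    {f : E n → H} (hf : IsBddSmoothOn (Sset n R) f) (m : ℕ) :
    ContDiffOn ℝ N (seeleyExt a b R m f) {x | 3 / 4 * R < ‖x‖} := by
  induction N generalizing H m with
  | zero =>
    rw [Nat.cast_zero, contDiffOn_zero]
    exact hab.continuousOn_seeleyExt hR hf m
  | succ N ih =>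
    have hf' := hf.fderivWithin (uniqueDiffOn_Sset hR)
    have hB : ContDiffOn ℝ N (fderiv ℝ (reflVec R : E n → E n)) {x | 3 / 4 * R < ‖x‖} :=
      ((contDiff_fderiv_reflVec R).of_le (mod_cast le_top)).contDiffOn
    push_cast
    rw [contDiffOn_succ_iff_fderiv_of_isOpen (isOpen_lt_norm _)]
    refine ⟨fun x hx =>
      (hab.hasFDerivAt_seeleyExt hR hf m hx).differentiableAt.differentiableWithinAt, by simp, ?_⟩
    exact (((ih hf' m).clm_comp (contDiffOn_const.add hB)).sub
      ((ih hf' (m + 1)).clm_comp hB)).congr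
        fun x hx => (hab.hasFDerivAt_seeleyExt hR hf m hx).fderiv

/-- **Seeley's extension theorem** for the exterior of a ball. -/
theorem IsBddSmoothOn.exists_extension [CompleteSpace H] {n : ℕ} {R : ℝ} (hR : 0 < R)
    {f : E n → H} (hf : IsBddSmoothOn (Sset n R) f) :
    ∃ g : E n → H, ContDiffOn ℝ ∞ g {x | 3 / 4 * R < ‖x‖} ∧ EqOn g f (Sset n R) := by
  obtain ⟨a, b, hab⟩ := exists_seeley_coeff
  have hab : IsSeeley a b := hab
  exact ⟨seeleyExt a b R 0 f,
    contDiffOn_infty.2 fun N => hab.contDiffOn_seeleyExt_nat hR N hf 0,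
    fun x hx => seeleyExt_of_le hx⟩

end SeeleySmoothness

lemma BigOh.isBddSmoothOn {n : ℕ} {R q : ℝ} (hR : 1 ≤ R) (hq : 0 ≤ q) {f : E n → ℝ}
    (hf : ContDiffOn ℝ ∞ f (Sset n R)) (hO : BigOh n R q f) : IsBddSmoothOn (Sset n R) f := by
  refine ⟨hf, fun j => ?_⟩
  obtain ⟨C, hC⟩ := hO j
  refine ⟨|C|, fun x hx => ?_⟩
  have h1 : 1 ≤ ‖x‖ := hR.trans hx
  calc ‖iteratedFDerivWithin ℝ j f (Sset n R) x‖
      ≤ ‖x‖ ^ j * ‖iteratedFDerivWithin ℝ j f (Sset n R) x‖ :=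
        le_mul_of_one_le_left (norm_nonneg _) (one_le_pow₀ h1)
    _ ≤ C * ‖x‖ ^ (-q) := hC x hx
    _ ≤ |C| * 1 := mul_le_mul (le_abs_self C) (rpow_le_one_of_one_le_of_nonpos h1 (by linarith))
        (by positivity) (abs_nonneg C)
    _ = |C| := mul_one _

lemma iteratedFDerivWithin_Sset {n : ℕ} {R : ℝ} {f : E n → ℝ} (j : ℕ) {x : E n} (hx : R < ‖x‖) :
    iteratedFDerivWithin ℝ j f (Sset n R) x = iteratedFDeriv ℝ j f x := by
  rw [← iteratedFDerivWithin_univ]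
  refine iteratedFDerivWithin_congr_set ?_ j
  rw [eventuallyEq_univ]
  exact Sset_mem_nhds hx

lemma BigOh.exists_norm_iteratedFDeriv_le {n : ℕ} {R q : ℝ} (hR : 0 < R) {f : E n → ℝ}
    (hO : BigOh n R q f) (j : ℕ) :
    ∃ C : ℝ, ∀ x, R < ‖x‖ → ‖iteratedFDeriv ℝ j f x‖ ≤ C * ‖x‖ ^ (-(q + j)) := by
  obtain ⟨C, hC⟩ := hO j
  refine ⟨C, fun x hx => ?_⟩
  have h0 : 0 < ‖x‖ := hR.trans hx
  have h := hC x hx.le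
  rw [iteratedFDerivWithin_Sset j hx, mul_comm, ← le_div_iff₀ (pow_pos h0 j)] at h
  refine h.trans_eq ?_
  rw [neg_add, rpow_add h0, rpow_neg h0.le (j : ℝ), rpow_natCast]
  ring

lemma exists_norm_iteratedFDeriv_le_of_contDiffOn {n : ℕ} {ρ r R q : ℝ} (hr : ρ < r) (hr0 : 0 < r)
    {f : E n → ℝ} (hf : ContDiffOn ℝ ∞ f {x | ρ < ‖x‖}) (j : ℕ) :
    ∃ C : ℝ, ∀ x, r ≤ ‖x‖ → ‖x‖ ≤ R → ‖iteratedFDeriv ℝ j f x‖ ≤ C * ‖x‖ ^ (-(q + j)) := by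
  have hK : IsCompact (Metric.closedBall (0 : E n) R ∩ Sset n r) :=
    (isCompact_closedBall _ _).inter_right (isClosed_le continuous_const continuous_norm)
  have hpos : ∀ x ∈ Metric.closedBall (0 : E n) R ∩ Sset n r, 0 < ‖x‖ := fun x hx =>
    hr0.trans_le hx.2
  have hc : ContinuousOn (fun x => iteratedFDeriv ℝ j f x) {x | ρ < ‖x‖} :=
    (hf.continuousOn_iteratedFDerivWithin (mod_cast le_top)
      (isOpen_lt_norm ρ).uniqueDiffOn).congr fun x hx =>
        (iteratedFDerivWithin_of_isOpen j (isOpen_lt_norm ρ) hx).symm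
  obtain ⟨C, hC⟩ := hK.exists_bound_of_continuousOn
    (f := fun x => ‖x‖ ^ (q + j) * ‖iteratedFDeriv ℝ j f x‖)
    ((continuousOn_id.norm.rpow_const fun x hx => Or.inl (hpos x hx).ne').mul
      (hc.mono fun x hx => hr.trans_le hx.2).norm)
  refine ⟨C, fun x h1 h2 => ?_⟩
  have h0 : 0 < ‖x‖ := hr0.trans_le h1
  have h := (le_norm_self _).trans (hC x ⟨mem_closedBall_zero_iff.2 h2, h1⟩)
  rw [mul_comm, ← le_div_iff₀ (rpow_pos_of_pos h0 _)] at h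
  rwa [rpow_neg h0.le, ← div_eq_mul_inv]

lemma BigOh.exists_isSymbol_eqOn {n : ℕ} {R q : ℝ} (hR : 1 ≤ R) (hq : 0 ≤ q) {f : E n → ℝ}
    (hf : ContDiffOn ℝ ∞ f (Sset n R)) (hO : BigOh n R q f) :
    ∃ g, IsSymbol q g ∧ EqOn g f (Sset n R) := by
  have hR0 : 0 < R := one_pos.trans_le hR
  obtain ⟨F, hF, hFf⟩ := (hO.isBddSmoothOn hR hq hf).exists_extension hR0
  obtain ⟨g, hg, hgF⟩ := exists_isSymbol_eq_of_lt_norm (ρ := 3 / 4 * R) (r := 7 / 8 * R) (q := q)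
    (by positivity) (by linarith) hF fun j => by
      obtain ⟨C₁, h₁⟩ := hO.exists_norm_iteratedFDeriv_le hR0 j
      obtain ⟨C₂, h₂⟩ := exists_norm_iteratedFDeriv_le_of_contDiffOn (ρ := 3 / 4 * R)
        (r := 7 / 8 * R) (R := R) (q := q) (by linarith) (by positivity) hF j
      refine ⟨max C₁ C₂, fun x hx => ?_⟩
      rcases lt_or_ge R ‖x‖ with h | h
      · have e : F =ᶠ[𝓝 x] f := mem_of_superset (Sset_mem_nhds h) hFf
        rw [(e.iteratedFDeriv ℝ j).eq_of_nhds]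
        exact (h₁ x h).trans (mul_le_mul_of_nonneg_right (le_max_left _ _) (by positivity))
      · exact (h₂ x hx.le h).trans
          (mul_le_mul_of_nonneg_right (le_max_right _ _) (by positivity))
  exact ⟨g, hg, fun x hx => (hgF x (le_trans (by linarith) hx)).trans (hFf hx)⟩

lemma IsSymbol.bigOh {n : ℕ} {R q : ℝ} (hR : 0 < R) (hq : 0 ≤ q) {f : E n → ℝ}
    (hf : IsSymbol q f) : BigOh n R q f := by
  intro j
  obtain ⟨C, hC⟩ := hf.2 j
  refine ⟨C, fun x hx => ?_⟩
  have h0 : 0 < ‖x‖ := hR.trans_le hx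
  rw [iteratedFDerivWithin_eq_iteratedFDeriv (uniqueDiffOn_Sset hR)
    (hf.1.contDiffAt.of_le (mod_cast le_top)) hx]
  calc ‖x‖ ^ j * ‖iteratedFDeriv ℝ j f x‖
      ≤ ‖x‖ ^ j * (C * ‖x‖ ^ (-(q + j))) := by
        refine mul_le_mul_of_nonneg_left ((hC j le_rfl x).trans ?_) (by positivity)
        refine mul_le_mul_of_nonneg_left (wt_rpow_le_norm_rpow h0 ?_) hC.nonneg
        have : (0 : ℝ) ≤ j := Nat.cast_nonneg j
        linarith
    _ = C * ‖x‖ ^ (-q) := by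
        rw [neg_add, rpow_add h0, rpow_neg h0.le (j : ℝ), rpow_natCast]
        field_simp

/-- Meyers: solvability of the Poisson equation `ΔV = G` with error
estimate: `G = O(-2-p-ε)` yields a solution `V = O(-p-ε)`. -/
theorem poisson_error_estimate (n : ℕ) (hn : 3 ≤ n) (R : ℝ) (hR : 1 ≤ R)
    (p : ℕ) (hp : 1 ≤ p) (ε : ℝ) (hε : ε ∈ Set.Ioo (0:ℝ) 1)
    (G : E n → ℝ) (hGsmooth : ContDiffOn ℝ (⊤ : ℕ∞) G (Sset n R))
    (hGO : BigOh n R (2 + p + ε) G) :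
    ∃ V : E n → ℝ, ContDiffOn ℝ (⊤ : ℕ∞) V (Sset n R) ∧
      (∀ x : E n, R < ‖x‖ → lap n V x = G x) ∧
      BigOh n R ((p:ℝ) + ε) V := by
  have hR0 : 0 < R := one_pos.trans_le hR
  obtain ⟨g, hg, hgG⟩ := hGO.exists_isSymbol_eqOn hR
    (by linarith [hε.1, Nat.cast_nonneg (α := ℝ) p]) hGsmooth
  obtain ⟨V, hV, hVg⟩ := exists_isSymbol_lap_eq hn hε hR0 p (G := g)
    (by rwa [show (p : ℝ) + ε + 2 = 2 + p + ε by ring])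
  exact ⟨V, hV.1.contDiffOn, fun x hx => (hVg x hx).trans (hgG hx.le),
    hV.bigOh hR0 (by linarith [hε.1, Nat.cast_nonneg (α := ℝ) p])⟩
end
end
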